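/- Soundness and completeness of Λ_R' with respect to bi-valued kiobt-models: a formula of L_R is a theorem of the proof system Λ_R' if and only if it is true at every index of every finite-choice bi-valued kiobt-model. -/

import Mathlib

namespace IEAUST

variable {Agent Mom : Type}

/-- Histories: maximal chains of moments. -/
abbrev Hist (lt : Mom → Mom → Prop) : Type _ := {s : Set Mom // IsMaxChain lt s}

/-- An index is a pair of a moment and a history passing through it. -/
structure Idx (lt : Mom → Mom → Prop) where
  mom : Mom
  hist : Hist lt
  mem : mom ∈ hist.val

/-- The ex ante information set of an agent at an index. -/
def exAnte {lt : Mom → Mom → Prop} (epi : Agent → Idx lt → Idx lt → Prop)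
    (a : Agent) (i : Idx lt) : Set (Idx lt) :=
  {j | ∃ (h'' : Hist lt) (p : j.mom ∈ h''.val), epi a i ⟨j.mom, h'', p⟩}

/-- A kiobt structure: branching time, choices, epistemic relations, intention
topologies and deontic value(s). -/
structure BiKiobtModel (Agent Mom : Type) (lt : Mom → Mom → Prop) where
  ags_fin : Finite Agent
  mom_ne : Nonempty Mom
  lt_irrefl : ∀ m, ¬ lt m m
  lt_trans : ∀ {m₁ m₂ m₃}, lt m₁ m₂ → lt m₂ m₃ → lt m₁ m₃
  no_bb : ∀ {m₁ m₂ m}, lt m₁ m → lt m₂ m → m₁ = m₂ ∨ lt m₁ m₂ ∨ lt m₂ m₁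
  Choice : Agent → Mom → Set (Set (Hist lt))
  choice_sub : ∀ a m, ∀ L ∈ Choice a m, ∀ h ∈ L, m ∈ (h : Hist lt).val
  choice_ne : ∀ a m, ∀ L ∈ Choice a m, L.Nonempty
  choice_cover : ∀ a m (h : Hist lt), m ∈ h.val → ∃ L ∈ Choice a m, h ∈ L
  choice_disj : ∀ a m, ∀ L ∈ Choice a m, ∀ L' ∈ Choice a m, ∀ h, h ∈ L → h ∈ L' → L = L'
  nc : ∀ a m m', lt m m' → ∀ h h' : Hist lt, m ∈ h.val → m ∈ h'.val →
        m' ∈ h.val → m' ∈ h'.val → ∀ L ∈ Choice a m, h ∈ L → h' ∈ L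
  ia : ∀ m (s : Agent → Set (Hist lt)), (∀ a, s a ∈ Choice a m) → (⋂ a, s a).Nonempty
  epi : Agent → Idx lt → Idx lt → Prop
  epi_equiv : ∀ a, Equivalence (epi a)
  oac : ∀ a (i j : Idx lt), epi a i j → ∀ L ∈ Choice a i.mom, i.hist ∈ L →
        ∀ h' ∈ L, ∀ p : i.mom ∈ (h' : Hist lt).val, epi a ⟨i.mom, h', p⟩ j
  unifH : ∀ a (i j : Idx lt), epi a i j → ∀ (h' : Hist lt) (p : i.mom ∈ h'.val),
        ∃ (h'' : Hist lt) (q : j.mom ∈ h''.val), epi a ⟨i.mom, h', p⟩ ⟨j.mom, h'', q⟩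
  tau : Agent → Idx lt → Set (Set (Idx lt))
  tau_sub : ∀ a i, ∀ U ∈ tau a i, U ⊆ exAnte epi a i
  tau_univ : ∀ a i, exAnte epi a i ∈ tau a i
  tau_empty : ∀ a i, (∅ : Set (Idx lt)) ∈ tau a i
  tau_inter : ∀ a i U V, U ∈ tau a i → V ∈ tau a i → U ∩ V ∈ tau a i
  tau_sUnion : ∀ a i (S : Set (Set (Idx lt))), S ⊆ tau a i → ⋃₀ S ∈ tau a i
  tau_ci : ∀ a i U V, U ∈ tau a i → V ∈ tau a i → U.Nonempty → V.Nonempty → (U ∩ V).Nonempty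
  tau_ki : ∀ a i j, exAnte epi a i = exAnte epi a j → tau a i = tau a j
  ValueO : Hist lt → ℝ
  ValueS : Hist lt → ℝ
  val : ℕ → Set (Idx lt)

variable {lt : Mom → Mom → Prop}

/-- The model is finite-choice if every choice partition has finitely many cells. -/
def FiniteChoice (M : BiKiobtModel Agent Mom lt) : Prop :=
  ∀ a m, (M.Choice a m).Finite

/-- `State^m_β`. -/
def stateSet (M : BiKiobtModel Agent Mom lt) (b : Agent) (m : Mom) : Set (Set (Hist lt)) :=
  {S | ∃ s : Agent → Set (Hist lt), (∀ a, s a ∈ M.Choice a m) ∧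
        S = ⋂ a ∈ {a : Agent | a ≠ b}, s a}

/-- `X ≤ Y` (ordering used for objective dominance). -/
def leVal (M : BiKiobtModel Agent Mom lt) (X Y : Set (Hist lt)) : Prop :=
  ∀ h ∈ X, ∀ h' ∈ Y, M.ValueO h ≤ M.ValueO h'

/-- `X ≤_s Y` (ordering used for subjective dominance). -/
def leValS (M : BiKiobtModel Agent Mom lt) (X Y : Set (Hist lt)) : Prop :=
  ∀ h ∈ X, ∀ h' ∈ Y, M.ValueS h ≤ M.ValueS h'

/-- Objective dominance `L ≼ L'`. -/
def domO (M : BiKiobtModel Agent Mom lt) (a : Agent) (m : Mom) (L L' : Set (Hist lt)) : Prop :=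
  ∀ S ∈ stateSet M a m, leVal M (L ∩ S) (L' ∩ S)

/-- Strict objective dominance `L ≺ L'`. -/
def sdomO (M : BiKiobtModel Agent Mom lt) (a : Agent) (m : Mom) (L L' : Set (Hist lt)) : Prop :=
  domO M a m L L' ∧ ¬ domO M a m L' L

/-- `Optimal^m_α`. -/
def optimal (M : BiKiobtModel Agent Mom lt) (a : Agent) (m : Mom) : Set (Set (Hist lt)) :=
  {L | L ∈ M.Choice a m ∧ ¬ ∃ L' ∈ M.Choice a m, sdomO M a m L L'}

/-- `m ∼_α m'` for moments. -/
def momRel (M : BiKiobtModel Agent Mom lt) (a : Agent) (m m' : Mom) : Prop :=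
  ∃ (i j : Idx lt), i.mom = m ∧ j.mom = m' ∧ M.epi a i j

/-- The epistemic cluster `[L]^m_α` of `L ⊆ H_{m*}` at `m`. -/
def cluster (M : BiKiobtModel Agent Mom lt) (a : Agent) (mstar : Mom)
    (L : Set (Hist lt)) (m : Mom) : Set (Hist lt) :=
  {h | ∃ (p : m ∈ h.val) (hs : Hist lt), hs ∈ L ∧
        ∃ q : mstar ∈ hs.val, M.epi a ⟨mstar, hs, q⟩ ⟨m, h, p⟩}

/-- Subjective dominance `L ≼_s L'`. -/
def domS (M : BiKiobtModel Agent Mom lt) (a : Agent) (mstar : Mom)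
    (L L' : Set (Hist lt)) : Prop :=
  ∀ m, momRel M a mstar m → ∀ S ∈ stateSet M a m,
    leValS M (cluster M a mstar L m ∩ S) (cluster M a mstar L' m ∩ S)

/-- Strict subjective dominance `L ≺_s L'`. -/
def sdomS (M : BiKiobtModel Agent Mom lt) (a : Agent) (mstar : Mom)
    (L L' : Set (Hist lt)) : Prop :=
  domS M a mstar L L' ∧ ¬ domS M a mstar L' L

/-- `SOptimal^m_α`. -/
def soptimal (M : BiKiobtModel Agent Mom lt) (a : Agent) (m : Mom) : Set (Set (Hist lt)) :=
  {L | L ∈ M.Choice a m ∧ ¬ ∃ L' ∈ M.Choice a m, sdomS M a m L L'}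

/-- Formulas of the language `L_R` (atomic propositions indexed by `ℕ`). -/
inductive Formula (Agent : Type) : Type
  | atom : ℕ → Formula Agent
  | neg : Formula Agent → Formula Agent
  | conj : Formula Agent → Formula Agent → Formula Agent
  | box : Formula Agent → Formula Agent
  | stit : Agent → Formula Agent → Formula Agent
  | know : Agent → Formula Agent → Formula Agent
  | intend : Agent → Formula Agent → Formula Agent
  | oughtO : Agent → Formula Agent → Formula Agent
  | oughtS : Agent → Formula Agent → Formula Agent

/-- `◇φ := ¬□¬φ`. -/
def Formula.diam (φ : Formula Agent) : Formula Agent := .neg (.box (.neg φ))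

/-- Material implication `φ → ψ := ¬(φ ∧ ¬ψ)`. -/
def Formula.imp (φ ψ : Formula Agent) : Formula Agent := .neg (.conj φ (.neg ψ))

/-- Truth at an index of a (finite-choice) kiobt-model. -/
def truth (M : BiKiobtModel Agent Mom lt) : Formula Agent → Idx lt → Prop
  | .atom n, i => i ∈ M.val n
  | .neg φ, i => ¬ truth M φ i
  | .conj φ ψ, i => truth M φ i ∧ truth M ψ i
  | .box φ, i => ∀ (h' : Hist lt) (p : i.mom ∈ h'.val), truth M φ ⟨i.mom, h', p⟩
  | .stit a φ, i => ∀ L ∈ M.Choice a i.mom, i.hist ∈ L →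
      ∀ h' ∈ L, ∀ p : i.mom ∈ (h' : Hist lt).val, truth M φ ⟨i.mom, h', p⟩
  | .know a φ, i => ∀ j, M.epi a i j → truth M φ j
  | .intend a φ, i => ∃ U ∈ M.tau a i, U.Nonempty ∧ ∀ j ∈ U, truth M φ j
  | .oughtO a φ, i => ∀ L ∈ optimal M a i.mom, ∀ h' ∈ L,
      ∀ p : i.mom ∈ (h' : Hist lt).val, truth M φ ⟨i.mom, h', p⟩
  | .oughtS a φ, i => ∀ L ∈ soptimal M a i.mom, ∀ m', momRel M a i.mom m' →
      ∀ h' ∈ cluster M a i.mom L m', ∀ p : m' ∈ (h' : Hist lt).val, truth M φ ⟨m', h', p⟩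

/-- Purely propositional formulas, used to state the axiom schema of
propositional tautologies. -/
inductive PropForm : Type
  | var : ℕ → PropForm
  | neg : PropForm → PropForm
  | conj : PropForm → PropForm → PropForm

/-- Classical evaluation of a propositional form. -/
def PropForm.eval (v : ℕ → Prop) : PropForm → Prop
  | .var n => v n
  | .neg p => ¬ PropForm.eval v p
  | .conj p q => PropForm.eval v p ∧ PropForm.eval v q

/-- Substitute formulas for the variables of a propositional form. -/
def PropForm.toFormula (σ : ℕ → Formula Agent) : PropForm → Formula Agent
  | .var n => σ n
  | .neg p => .neg (PropForm.toFormula σ p)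
  | .conj p q => .conj (PropForm.toFormula σ p) (PropForm.toFormula σ q)

/-- `φ` is a substitution instance of a classical propositional tautology. -/
def Formula.isTautInstance (φ : Formula Agent) : Prop :=
  ∃ (p : PropForm) (σ : ℕ → Formula Agent),
    (∀ v : ℕ → Prop, PropForm.eval v p) ∧ φ = PropForm.toFormula σ p

/-- Uniform substitution of formulas for atomic propositions. -/
def Formula.subst (σ : ℕ → Formula Agent) : Formula Agent → Formula Agent
  | .atom n => σ n
  | .neg φ => .neg (Formula.subst σ φ)
  | .conj φ ψ => .conj (Formula.subst σ φ) (Formula.subst σ ψ)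
  | .box φ => .box (Formula.subst σ φ)
  | .stit a φ => .stit a (Formula.subst σ φ)
  | .know a φ => .know a (Formula.subst σ φ)
  | .intend a φ => .intend a (Formula.subst σ φ)
  | .oughtO a φ => .oughtO a (Formula.subst σ φ)
  | .oughtS a φ => .oughtS a (Formula.subst σ φ)

/-- Conjunction of a nonempty list of formulas (head and tail). -/
def bigConj : Formula Agent → List (Formula Agent) → Formula Agent
  | φ, [] => φ
  | φ, ψ :: l => .conj φ (bigConj ψ l)

/-- The proof system `Lambda_R'`. -/
inductive Lambda_R' {Agent : Type} : Formula Agent → Prop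
  /-- All classical propositional tautologies. -/
  | taut {φ : Formula Agent} : φ.isTautInstance → Lambda_R' φ
  /-- S5 for `□`: K. -/
  | boxK (φ ψ : Formula Agent) :
      Lambda_R' ((Formula.box (φ.imp ψ)).imp ((Formula.box φ).imp (Formula.box ψ)))
  /-- S5 for `□`: T. -/
  | boxT (φ : Formula Agent) : Lambda_R' ((Formula.box φ).imp φ)
  /-- S5 for `□`: 5. -/
  | box5 (φ : Formula Agent) :
      Lambda_R' ((Formula.diam φ).imp (Formula.box (Formula.diam φ)))
  /-- S5 for `[α]`: K. -/
  | stitK (a : Agent) (φ ψ : Formula Agent) :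
      Lambda_R' ((Formula.stit a (φ.imp ψ)).imp ((Formula.stit a φ).imp (Formula.stit a ψ)))
  /-- S5 for `[α]`: T. -/
  | stitT (a : Agent) (φ : Formula Agent) : Lambda_R' ((Formula.stit a φ).imp φ)
  /-- S5 for `[α]`: 5. -/
  | stit5 (a : Agent) (φ : Formula Agent) :
      Lambda_R' ((Formula.neg (Formula.stit a (Formula.neg φ))).imp
        (Formula.stit a (Formula.neg (Formula.stit a (Formula.neg φ)))))
  /-- S5 for `K_α`: K. -/
  | knowK (a : Agent) (φ ψ : Formula Agent) :
      Lambda_R' ((Formula.know a (φ.imp ψ)).imp ((Formula.know a φ).imp (Formula.know a ψ)))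
  /-- S5 for `K_α`: T. -/
  | knowT (a : Agent) (φ : Formula Agent) : Lambda_R' ((Formula.know a φ).imp φ)
  /-- S5 for `K_α`: 5. -/
  | know5 (a : Agent) (φ : Formula Agent) :
      Lambda_R' ((Formula.neg (Formula.know a (Formula.neg φ))).imp
        (Formula.know a (Formula.neg (Formula.know a (Formula.neg φ)))))
  /-- KD for `I_α`: K. -/
  | intK (a : Agent) (φ ψ : Formula Agent) :
      Lambda_R' ((Formula.intend a (φ.imp ψ)).imp
        ((Formula.intend a φ).imp (Formula.intend a ψ)))
  /-- KD for `I_α`: D. -/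
  | intD (a : Agent) (φ : Formula Agent) :
      Lambda_R' ((Formula.intend a φ).imp (Formula.neg (Formula.intend a (Formula.neg φ))))
  /-- (SET). -/
  | set (a : Agent) (φ : Formula Agent) : Lambda_R' ((Formula.box φ).imp (Formula.stit a φ))
  /-- (IA), for pairwise-distinct agents. -/
  | indep (p : Agent × Formula Agent) (l : List (Agent × Formula Agent))
      (hd : ((p :: l).map Prod.fst).Nodup) :
      Lambda_R' ((bigConj (Formula.diam (Formula.stit p.1 p.2))
          (l.map fun q => Formula.diam (Formula.stit q.1 q.2))).imp
        (Formula.diam (bigConj (Formula.stit p.1 p.2)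
          (l.map fun q => Formula.stit q.1 q.2))))
  /-- (OAC). -/
  | oac (a : Agent) (φ : Formula Agent) : Lambda_R' ((Formula.know a φ).imp (Formula.stit a φ))
  /-- (Unif-H). -/
  | unifH (a : Agent) (φ : Formula Agent) :
      Lambda_R' ((Formula.diam (Formula.know a φ)).imp (Formula.know a (Formula.diam φ)))
  /-- (A1). -/
  | a1 (a : Agent) (φ ψ : Formula Agent) :
      Lambda_R' ((Formula.oughtO a (φ.imp ψ)).imp
        ((Formula.oughtO a φ).imp (Formula.oughtO a ψ)))
  /-- (A2). -/
  | a2 (a : Agent) (φ : Formula Agent) : Lambda_R' ((Formula.box φ).imp (Formula.oughtO a φ))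
  /-- (A3). -/
  | a3 (a : Agent) (φ : Formula Agent) :
      Lambda_R' ((Formula.oughtO a φ).imp (Formula.box (Formula.oughtO a φ)))
  /-- (A4). -/
  | a4 (a : Agent) (φ : Formula Agent) :
      Lambda_R' ((Formula.oughtO a φ).imp (Formula.oughtO a (Formula.stit a φ)))
  /-- (Oic). -/
  | oic (a : Agent) (φ : Formula Agent) :
      Lambda_R' ((Formula.oughtO a φ).imp (Formula.diam (Formula.stit a φ)))
  /-- (A5). -/
  | a5 (a : Agent) (φ ψ : Formula Agent) :
      Lambda_R' ((Formula.oughtS a (φ.imp ψ)).imp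
        ((Formula.oughtS a φ).imp (Formula.oughtS a ψ)))
  /-- (A6). -/
  | a6 (a : Agent) (φ : Formula Agent) :
      Lambda_R' ((Formula.oughtS a φ).imp (Formula.oughtS a (Formula.know a φ)))
  /-- (SuN). -/
  | suN (a : Agent) (φ : Formula Agent) :
      Lambda_R' ((Formula.know a (Formula.box φ)).imp (Formula.oughtS a φ))
  /-- (s.Oic). -/
  | sOic (a : Agent) (φ : Formula Agent) :
      Lambda_R' ((Formula.oughtS a φ).imp (Formula.diam (Formula.know a φ)))
  /-- (s.Cl). -/
  | sCl (a : Agent) (φ : Formula Agent) :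
      Lambda_R' ((Formula.oughtS a φ).imp (Formula.know a (Formula.box (Formula.oughtS a φ))))
  /-- (InN). -/
  | inN (a : Agent) (φ : Formula Agent) :
      Lambda_R' ((Formula.box (Formula.know a φ)).imp (Formula.intend a φ))
  /-- (KI). -/
  | ki (a : Agent) (φ : Formula Agent) :
      Lambda_R' ((Formula.intend a φ).imp (Formula.box (Formula.know a (Formula.intend a φ))))
  /-- Modus ponens. -/
  | mp {φ ψ : Formula Agent} : Lambda_R' (φ.imp ψ) → Lambda_R' φ → Lambda_R' ψ
  /-- Uniform substitution. -/
  | subst {φ : Formula Agent} (σ : ℕ → Formula Agent) :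
      Lambda_R' φ → Lambda_R' (φ.subst σ)
  /-- Necessitation for `□`. -/
  | necBox {φ : Formula Agent} : Lambda_R' φ → Lambda_R' (Formula.box φ)
  /-- Necessitation for `[α]`. -/
  | necStit (a : Agent) {φ : Formula Agent} : Lambda_R' φ → Lambda_R' (Formula.stit a φ)
  /-- Necessitation for `K_α`. -/
  | necKnow (a : Agent) {φ : Formula Agent} : Lambda_R' φ → Lambda_R' (Formula.know a φ)
  /-- Necessitation for `I_α`. -/
  | necInt (a : Agent) {φ : Formula Agent} : Lambda_R' φ → Lambda_R' (Formula.intend a φ)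
  /-- Necessitation for `⊙_α`. -/
  | necOO (a : Agent) {φ : Formula Agent} : Lambda_R' φ → Lambda_R' (Formula.oughtO a φ)
  /-- Necessitation for `⊙^S_α`. -/
  | necOS (a : Agent) {φ : Formula Agent} : Lambda_R' φ → Lambda_R' (Formula.oughtS a φ)

/-! ### Soundness -/

section Soundness

variable (M : BiKiobtModel Agent Mom lt)

@[simp] theorem truth_imp (φ ψ : Formula Agent) (i : Idx lt) :
    truth M (φ.imp ψ) i ↔ (truth M φ i → truth M ψ i) := by
  simp [Formula.imp, truth]

theorem truth_diam (φ : Formula Agent) (i : Idx lt) :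
    truth M φ.diam i ↔ ∃ (h : Hist lt) (p : i.mom ∈ h.val), truth M φ ⟨i.mom, h, p⟩ := by
  simp [Formula.diam, truth]

theorem truth_toFormula (p : PropForm) (σ : ℕ → Formula Agent) (i : Idx lt) :
    truth M (p.toFormula σ) i ↔ p.eval fun n => truth M (σ n) i := by
  induction p with
  | var n => rfl
  | neg p ih => simp [PropForm.toFormula, PropForm.eval, truth, ih]
  | conj p q ihp ihq => simp [PropForm.toFormula, PropForm.eval, truth, ihp, ihq]

/-- The model whose valuation interprets each atom `n` as the formula `σ n`. -/
def BiKiobtModel.substVal (σ : ℕ → Formula Agent) : BiKiobtModel Agent Mom lt :=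
  { M with val := fun n => {i | truth M (σ n) i} }

theorem truth_subst (σ : ℕ → Formula Agent) (φ : Formula Agent) :
    ∀ i : Idx lt, truth M (φ.subst σ) i ↔ truth (M.substVal σ) φ i := by
  induction φ with
  | atom n => intro i; rfl
  | neg φ ih => intro i; exact not_congr (ih i)
  | conj φ ψ ihp ihq => intro i; exact and_congr (ihp i) (ihq i)
  | box φ ih => intro i; exact forall₂_congr fun h p => ih _
  | stit a φ ih =>
    intro i
    exact forall₃_congr fun L hL hi => forall₃_congr fun h hh p => ih _
  | know a φ ih => intro i; exact forall₂_congr fun j hj => ih _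
  | intend a φ ih =>
    intro i
    exact exists_congr fun U => and_congr Iff.rfl (and_congr Iff.rfl
      (forall₂_congr fun j hj => ih _))
  | oughtO a φ ih =>
    intro i
    exact forall₂_congr fun L hL => forall₃_congr fun h hh p => ih _
  | oughtS a φ ih =>
    intro i
    exact forall₂_congr fun L hL => forall₂_congr fun m hm => forall₃_congr fun h hh p => ih _

theorem truth_bigConj (i : Idx lt) (l : List (Formula Agent)) (φ : Formula Agent) :
    truth M (bigConj φ l) i ↔ ∀ ψ ∈ φ :: l, truth M ψ i := by
  induction l generalizing φ with
  | nil => simp [bigConj]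
  | cons ψ l ih => simp only [bigConj, truth, ih, List.forall_mem_cons]

variable {M}

theorem exists_choice (a : Agent) (i : Idx lt) : ∃ L ∈ M.Choice a i.mom, i.hist ∈ L :=
  M.choice_cover a i.mom i.hist i.mem

theorem Choice.inter_state_nonempty {b : Agent} {m : Mom} {L S : Set (Hist lt)}
    (hL : L ∈ M.Choice b m) (hS : S ∈ stateSet M b m) : (L ∩ S).Nonempty := by
  classical
  obtain ⟨s, hs, rfl⟩ := hS
  obtain ⟨h, hh⟩ := M.ia m (Function.update s b L) (fun a => by
    by_cases hab : a = b
    · subst hab; simpa using hL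
    · simpa [hab] using hs a)
  rw [Set.mem_iInter] at hh
  refine ⟨h, by simpa using hh b, ?_⟩
  simp only [Set.mem_iInter]
  intro a ha
  have hab : a ≠ b := ha
  simpa [hab] using hh a

theorem domO_trans {a : Agent} {m : Mom} {L₁ L₂ L₃ : Set (Hist lt)} (h₂ : L₂ ∈ M.Choice a m)
    (h12 : domO M a m L₁ L₂) (h23 : domO M a m L₂ L₃) : domO M a m L₁ L₃ := by
  intro S hS h hh h' hh'
  obtain ⟨k, hk⟩ := Choice.inter_state_nonempty h₂ hS
  exact (h12 S hS h hh k hk).trans (h23 S hS k hk h' hh')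

theorem epi_of_mem_cell {a : Agent} {m : Mom} {L : Set (Hist lt)} (hL : L ∈ M.Choice a m)
    {h h' : Hist lt} (hh : h ∈ L) (hh' : h' ∈ L) (p : m ∈ h.val) (p' : m ∈ h'.val) :
    M.epi a ⟨m, h, p⟩ ⟨m, h', p'⟩ :=
  (M.epi_equiv a).symm
    (M.oac a ⟨m, h, p⟩ ⟨m, h, p⟩ ((M.epi_equiv a).refl _) L hL hh h' hh' p')

theorem mem_cluster_iff {a : Agent} {m m' : Mom} {L : Set (Hist lt)} (hL : L ∈ M.Choice a m)
    {h h' : Hist lt} (hh : h ∈ L) (p : m ∈ h.val) (p' : m' ∈ h'.val) :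
    h' ∈ cluster M a m L m' ↔ M.epi a ⟨m, h, p⟩ ⟨m', h', p'⟩ := by
  constructor
  · rintro ⟨_, k, hk, q, e⟩
    exact (M.epi_equiv a).trans (epi_of_mem_cell hL hh hk p q) e
  · exact fun e => ⟨p', h, hh, p, e⟩

/-- Agents who cannot distinguish two moments have matching indices at them. -/
theorem momRel.exists_epi {a : Agent} {m m' : Mom} (hm : momRel M a m m') {h : Hist lt}
    (p : m ∈ h.val) : ∃ (h' : Hist lt) (q : m' ∈ h'.val), M.epi a ⟨m, h, p⟩ ⟨m', h', q⟩ := by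
  obtain ⟨i, j, rfl, rfl, e⟩ := hm
  exact M.unifH a i j e h p

theorem momRel.symm {a : Agent} {m m' : Mom} (hm : momRel M a m m') : momRel M a m' m := by
  obtain ⟨i, j, hi, hj, e⟩ := hm
  exact ⟨j, i, hj, hi, (M.epi_equiv a).symm e⟩

theorem momRel.trans {a : Agent} {m₁ m₂ m₃ : Mom} (h12 : momRel M a m₁ m₂)
    (h23 : momRel M a m₂ m₃) : momRel M a m₁ m₃ := by
  obtain ⟨i, j, rfl, rfl, e⟩ := h12
  obtain ⟨h, q, e'⟩ := h23.exists_epi j.mem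
  exact ⟨i, ⟨m₃, h, q⟩, rfl, rfl, (M.epi_equiv a).trans e e'⟩

theorem cluster_inter_state_nonempty {a : Agent} {m m' : Mom} {L S : Set (Hist lt)}
    (hL : L ∈ M.Choice a m) (hm : momRel M a m m') (hS : S ∈ stateSet M a m') :
    (cluster M a m L m' ∩ S).Nonempty := by
  obtain ⟨h, hh⟩ := M.choice_ne a m L hL
  have p := M.choice_sub a m L hL h hh
  obtain ⟨h', q, e⟩ := hm.exists_epi p
  obtain ⟨L', hL', hh'⟩ := M.choice_cover a m' h' q
  obtain ⟨k, hk, hkS⟩ := Choice.inter_state_nonempty hL' hS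
  have pk := M.choice_sub a m' L' hL' k hk
  exact ⟨k, (mem_cluster_iff hL hh p pk).2
    ((M.epi_equiv a).trans e (epi_of_mem_cell hL' hh' hk q pk)), hkS⟩

theorem domS_trans {a : Agent} {m : Mom} {L₁ L₂ L₃ : Set (Hist lt)} (h₂ : L₂ ∈ M.Choice a m)
    (h12 : domS M a m L₁ L₂) (h23 : domS M a m L₂ L₃) : domS M a m L₁ L₃ := by
  intro m' hm S hS h hh h' hh'
  obtain ⟨k, hk⟩ := cluster_inter_state_nonempty h₂ hm hS
  exact (h12 m' hm S hS h hh k hk).trans (h23 m' hm S hS k hk h' hh')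

/-- A finite nonempty set has an element that is maximal for the strict part of a relation
that is transitive on the set. -/
theorem exists_not_strictly_below {α : Type*} {s : Set α} (hs : s.Finite) (hne : s.Nonempty)
    (r : α → α → Prop)
    (hr : ∀ x ∈ s, ∀ y ∈ s, ∀ z ∈ s, r x y → r y z → r x z) :
    ∃ x ∈ s, ¬ ∃ y ∈ s, r x y ∧ ¬ r y x := by
  classical
  have : Finite s := hs
  let t : s → s → Prop := fun y x => r x y ∧ ¬ r y x
  have : IsTrans s t := ⟨fun x y z hxy hyz =>
    ⟨hr _ z.2 _ y.2 _ x.2 hyz.1 hxy.1, fun h => hxy.2 (hr _ x.2 _ z.2 _ y.2 h hyz.1)⟩⟩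
  have : Std.Irrefl t := ⟨fun x h => h.2 h.1⟩
  obtain ⟨x, -, hx⟩ := (Finite.wellFounded_of_trans_of_irrefl t).has_min Set.univ
    ⟨⟨_, hne.choose_spec⟩, trivial⟩
  exact ⟨x, x.2, fun ⟨y, hy, h⟩ => hx ⟨y, hy⟩ trivial h⟩

theorem choice_nonempty (a : Agent) (i : Idx lt) : (M.Choice a i.mom).Nonempty :=
  let ⟨L, hL, _⟩ := exists_choice (M := M) a i
  ⟨L, hL⟩

theorem optimal_nonempty (hM : FiniteChoice M) (a : Agent) (i : Idx lt) :
    (optimal M a i.mom).Nonempty := by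
  obtain ⟨L, hL, h⟩ := exists_not_strictly_below (hM a i.mom) (choice_nonempty a i)
    (domO M a i.mom) fun x _ y hy z _ => domO_trans hy
  exact ⟨L, hL, h⟩

theorem soptimal_nonempty (hM : FiniteChoice M) (a : Agent) (i : Idx lt) :
    (soptimal M a i.mom).Nonempty := by
  obtain ⟨L, hL, h⟩ := exists_not_strictly_below (hM a i.mom) (choice_nonempty a i)
    (domS M a i.mom) fun x _ y hy z _ => domS_trans hy
  exact ⟨L, hL, h⟩

theorem momRel_refl (a : Agent) (i : Idx lt) : momRel M a i.mom i.mom :=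
  ⟨i, i, rfl, rfl, (M.epi_equiv a).refl i⟩

theorem cluster_eq_of_epi {a : Agent} {m₁ m₂ : Mom} {L₁ L₂ : Set (Hist lt)}
    (h₁ : L₁ ∈ M.Choice a m₁) (h₂ : L₂ ∈ M.Choice a m₂) {k₁ k₂ : Hist lt} (hk₁ : k₁ ∈ L₁)
    (hk₂ : k₂ ∈ L₂) (p₁ : m₁ ∈ k₁.val) (p₂ : m₂ ∈ k₂.val)
    (e : M.epi a ⟨m₁, k₁, p₁⟩ ⟨m₂, k₂, p₂⟩) (m : Mom) :
    cluster M a m₁ L₁ m = cluster M a m₂ L₂ m := by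
  ext h
  constructor
  · intro hh
    obtain ⟨q, -⟩ := id hh
    rw [mem_cluster_iff h₁ hk₁ p₁ q] at hh
    exact (mem_cluster_iff h₂ hk₂ p₂ q).2
      ((M.epi_equiv a).trans ((M.epi_equiv a).symm e) hh)
  · intro hh
    obtain ⟨q, -⟩ := id hh
    rw [mem_cluster_iff h₂ hk₂ p₂ q] at hh
    exact (mem_cluster_iff h₁ hk₁ p₁ q).2 ((M.epi_equiv a).trans e hh)

/-- Every cell at a moment has a counterpart, with the same clusters, at each moment that the
agent cannot distinguish from it. -/
theorem exists_counterpart {a : Agent} {m m' : Mom} (hm : momRel M a m m')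
    {L : Set (Hist lt)} (hL : L ∈ M.Choice a m) :
    ∃ L' ∈ M.Choice a m', ∀ m'', cluster M a m L m'' = cluster M a m' L' m'' := by
  obtain ⟨h, hh⟩ := M.choice_ne a m L hL
  have p := M.choice_sub a m L hL h hh
  obtain ⟨h', q, e⟩ := hm.exists_epi p
  obtain ⟨L', hL', hh'⟩ := M.choice_cover a m' h' q
  exact ⟨L', hL', cluster_eq_of_epi hL hL' hh hh' p q e⟩

theorem domS_congr {a : Agent} {m m' : Mom} (hm : momRel M a m m')
    {L K L' K' : Set (Hist lt)} (hL : ∀ m'', cluster M a m L m'' = cluster M a m' L' m'')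
    (hK : ∀ m'', cluster M a m K m'' = cluster M a m' K' m'') :
    domS M a m L K ↔ domS M a m' L' K' := by
  unfold domS
  refine forall_congr' fun m'' => ?_
  rw [hL, hK]
  exact ⟨fun h hm'' => h (hm.trans hm''), fun h hm'' => h (hm.symm.trans hm'')⟩

theorem exists_soptimal_counterpart {a : Agent} {m m' : Mom} (hm : momRel M a m m')
    {L : Set (Hist lt)} (hL : L ∈ soptimal M a m) :
    ∃ L' ∈ soptimal M a m', ∀ m'', cluster M a m L m'' = cluster M a m' L' m'' := by
  obtain ⟨L', hL', hc⟩ := exists_counterpart hm hL.1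
  refine ⟨L', ⟨hL', ?_⟩, hc⟩
  rintro ⟨K', hK', h, h'⟩
  obtain ⟨K, hK, hKc⟩ := exists_counterpart hm.symm hK'
  have hKc' := fun m'' => (hKc m'').symm
  exact hL.2 ⟨K, hK, (domS_congr hm hc hKc').2 h, fun h'' => h' ((domS_congr hm hKc' hc).1 h'')⟩

theorem truth_stit_iff {a : Agent} {φ : Formula Agent} {m : Mom} {h : Hist lt} {p : m ∈ h.val}
    {L : Set (Hist lt)} (hL : L ∈ M.Choice a m) (hh : h ∈ L) :
    truth M (.stit a φ) ⟨m, h, p⟩ ↔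
      ∀ h' ∈ L, ∀ p' : m ∈ (h' : Hist lt).val, truth M φ ⟨m, h', p'⟩ := by
  constructor
  · exact fun H => H L hL hh
  · intro H L' hL' hh'
    obtain rfl := M.choice_disj a m L hL L' hL' h hh hh'
    exact H

theorem exAnte_nonempty (a : Agent) (i : Idx lt) : (exAnte M.epi a i).Nonempty :=
  ⟨i, i.hist, i.mem, (M.epi_equiv a).refl i⟩

theorem exAnte_mono {a : Agent} {i j : Idx lt} (h : momRel M a i.mom j.mom) :
    exAnte M.epi a j ⊆ exAnte M.epi a i := by
  rintro k ⟨h', p, e⟩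
  exact (h.trans ⟨j, ⟨k.mom, h', p⟩, rfl, rfl, e⟩).exists_epi i.mem

theorem tau_eq_of_momRel {a : Agent} {i j : Idx lt} (h : momRel M a i.mom j.mom) :
    M.tau a i = M.tau a j :=
  M.tau_ki a i j ((exAnte_mono h.symm).antisymm (exAnte_mono h))

theorem exists_selection (m : Mom) {h : Hist lt} (p : m ∈ h.val) (l : List (Agent × Formula Agent))
    (hd : (l.map Prod.fst).Nodup)
    (H : ∀ q ∈ l, ∃ (h' : Hist lt) (p' : m ∈ h'.val), truth M (.stit q.1 q.2) ⟨m, h', p'⟩) :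
    ∃ s : Agent → Set (Hist lt), (∀ a, s a ∈ M.Choice a m) ∧
      ∀ q ∈ l, ∀ h' ∈ s q.1, ∀ p' : m ∈ (h' : Hist lt).val, truth M (.stit q.1 q.2) ⟨m, h', p'⟩ := by
  have key : ∀ a : Agent, ∃ L ∈ M.Choice a m, ∀ q ∈ l, q.1 = a →
      ∀ h' ∈ L, ∀ p' : m ∈ (h' : Hist lt).val, truth M (.stit q.1 q.2) ⟨m, h', p'⟩ := by
    intro a
    by_cases ha : ∃ q ∈ l, q.1 = a
    · obtain ⟨q, hq, rfl⟩ := ha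
      obtain ⟨h', p', ht⟩ := H q hq
      obtain ⟨L, hL, hh'⟩ := M.choice_cover q.1 m h' p'
      refine ⟨L, hL, fun q' hq' hqq h'' hh'' p'' => ?_⟩
      obtain rfl := List.inj_on_of_nodup_map hd hq' hq hqq
      rw [truth_stit_iff hL hh'] at ht
      exact (truth_stit_iff hL hh'').2 ht
    · obtain ⟨L, hL, -⟩ := M.choice_cover a m h p
      exact ⟨L, hL, fun q hq hqa => absurd ⟨q, hq, hqa⟩ ha⟩
  choose s hs hs' using key
  exact ⟨s, hs, fun q hq => hs' q.1 q hq rfl⟩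

theorem Lambda_R'.sound {φ : Formula Agent} (hφ : Lambda_R' φ) :
    ∀ (Mom : Type) (lt : Mom → Mom → Prop) (M : BiKiobtModel Agent Mom lt),
      FiniteChoice M → ∀ i : Idx lt, truth M φ i := by
  induction hφ with
  | taut h =>
    obtain ⟨p, σ, hp, rfl⟩ := h
    exact fun _ _ M _ i => (truth_toFormula M p σ i).2 (hp _)
  | mp _ _ ih₁ ih₂ =>
    exact fun Mom lt M hM i => (truth_imp M _ _ i).1 (ih₁ Mom lt M hM i) (ih₂ Mom lt M hM i)
  | subst σ _ ih =>
    exact fun Mom lt M hM i => (truth_subst M σ _ i).2 (ih Mom lt (M.substVal σ) hM i)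
  | necBox _ ih => exact fun Mom lt M hM i h p => ih Mom lt M hM _
  | necStit a _ ih => exact fun Mom lt M hM i L hL hi h hh p => ih Mom lt M hM _
  | necKnow a _ ih => exact fun Mom lt M hM i j hj => ih Mom lt M hM _
  | necInt a _ ih =>
    exact fun Mom lt M hM i =>
      ⟨_, M.tau_univ a i, exAnte_nonempty a i, fun j _ => ih Mom lt M hM _⟩
  | necOO a _ ih => exact fun Mom lt M hM i L hL h hh p => ih Mom lt M hM _
  | necOS a _ ih => exact fun Mom lt M hM i L hL m hm h hh p => ih Mom lt M hM _
  | boxK φ ψ =>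
    intro Mom lt M hM i
    simp only [truth_imp]
    exact fun h₁ h₂ h p => (truth_imp M _ _ _).1 (h₁ h p) (h₂ h p)
  | boxT φ =>
    intro Mom lt M hM i
    rw [truth_imp]
    exact fun h => h i.hist i.mem
  | box5 φ =>
    intro Mom lt M hM i
    rw [truth_imp, truth_diam]
    exact fun h h' p' => (truth_diam M _ _).2 h
  | stitK a φ ψ =>
    intro Mom lt M hM i
    simp only [truth_imp]
    exact fun h₁ h₂ L hL hi h hh p =>
      (truth_imp M _ _ _).1 (h₁ L hL hi h hh p) (h₂ L hL hi h hh p)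
  | stitT a φ =>
    intro Mom lt M hM i
    rw [truth_imp]
    obtain ⟨L, hL, hi⟩ := exists_choice (M := M) a i
    exact fun h => h L hL hi i.hist hi i.mem
  | stit5 a φ =>
    intro Mom lt M hM i
    rw [truth_imp]
    intro H L hL hi h hh p H'
    exact H ((truth_stit_iff hL hi).2 ((truth_stit_iff hL hh).1 H'))
  | knowK a φ ψ =>
    intro Mom lt M hM i
    simp only [truth_imp]
    exact fun h₁ h₂ j hj => (truth_imp M _ _ _).1 (h₁ j hj) (h₂ j hj)
  | knowT a φ =>
    intro Mom lt M hM i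
    rw [truth_imp]
    exact fun h => h i ((M.epi_equiv a).refl i)
  | know5 a φ =>
    intro Mom lt M hM i
    rw [truth_imp]
    intro H j hj H'
    exact H fun k hk => H' k ((M.epi_equiv a).trans ((M.epi_equiv a).symm hj) hk)
  | intK a φ ψ =>
    intro Mom lt M hM i
    simp only [truth_imp]
    rintro ⟨U, hU, hUn, h₁⟩ ⟨V, hV, hVn, h₂⟩
    exact ⟨U ∩ V, M.tau_inter a i U V hU hV, M.tau_ci a i U V hU hV hUn hVn,
      fun j hj => (truth_imp M _ _ _).1 (h₁ j hj.1) (h₂ j hj.2)⟩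
  | intD a φ =>
    intro Mom lt M hM i
    rw [truth_imp]
    rintro ⟨U, hU, hUn, h₁⟩ ⟨V, hV, hVn, h₂⟩
    obtain ⟨j, hjU, hjV⟩ := M.tau_ci a i U V hU hV hUn hVn
    exact h₂ j hjV (h₁ j hjU)
  | set a φ =>
    intro Mom lt M hM i
    rw [truth_imp]
    exact fun h L hL hi h' hh' p => h h' p
  | indep p l hd =>
    intro Mom lt M hM i
    rw [truth_imp, truth_diam, truth_bigConj]
    intro H
    have H' : ∀ q ∈ p :: l, ∃ (h' : Hist lt) (p' : i.mom ∈ h'.val),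
        truth M (.stit q.1 q.2) ⟨i.mom, h', p'⟩ := by
      intro q hq
      rw [← truth_diam M _ i]
      rcases List.mem_cons.1 hq with rfl | hq
      · exact H _ List.mem_cons_self
      · exact H _ (List.mem_cons_of_mem _ (List.mem_map.2 ⟨q, hq, rfl⟩))
    obtain ⟨s, hs, hs'⟩ := exists_selection i.mom i.mem (p :: l) hd H'
    obtain ⟨h, hh⟩ := M.ia i.mom s hs
    rw [Set.mem_iInter] at hh
    have hp := M.choice_sub _ _ _ (hs p.1) h (hh p.1)
    refine ⟨h, hp, ?_⟩
    rw [truth_bigConj]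
    intro ψ hψ
    have : ∃ q ∈ p :: l, ψ = .stit q.1 q.2 := by
      rcases List.mem_cons.1 hψ with rfl | hψ
      · exact ⟨p, List.mem_cons_self, rfl⟩
      · obtain ⟨q, hq, rfl⟩ := List.mem_map.1 hψ
        exact ⟨q, List.mem_cons_of_mem _ hq, rfl⟩
    obtain ⟨q, hq, rfl⟩ := this
    exact hs' q hq h (hh q.1) hp
  | oac a φ =>
    intro Mom lt M hM i
    rw [truth_imp]
    exact fun H L hL hi h hh p => H _ (epi_of_mem_cell hL hi hh i.mem p)
  | unifH a φ =>
    intro Mom lt M hM i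
    rw [truth_imp, truth_diam]
    rintro ⟨h, p, H⟩ j hj
    obtain ⟨h', q, e⟩ := M.unifH a i j hj h p
    exact (truth_diam M _ _).2 ⟨h', q, H _ e⟩
  | a1 a φ ψ =>
    intro Mom lt M hM i
    simp only [truth_imp]
    exact fun h₁ h₂ L hL h hh p => (truth_imp M _ _ _).1 (h₁ L hL h hh p) (h₂ L hL h hh p)
  | a2 a φ =>
    intro Mom lt M hM i
    rw [truth_imp]
    exact fun H L hL h hh p => H h p
  | a3 a φ =>
    intro Mom lt M hM i
    rw [truth_imp]
    exact fun H h p => H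
  | a4 a φ =>
    intro Mom lt M hM i
    rw [truth_imp]
    exact fun H L hL h hh p => (truth_stit_iff hL.1 hh).2 (H L hL)
  | oic a φ =>
    intro Mom lt M hM i
    rw [truth_imp, truth_diam]
    intro H
    obtain ⟨L, hL⟩ := optimal_nonempty hM a i
    obtain ⟨h, hh⟩ := M.choice_ne _ _ L hL.1
    exact ⟨h, M.choice_sub _ _ L hL.1 h hh, (truth_stit_iff hL.1 hh).2 (H L hL)⟩
  | a5 a φ ψ =>
    intro Mom lt M hM i
    simp only [truth_imp]
    exact fun h₁ h₂ L hL m hm h hh p =>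
      (truth_imp M _ _ _).1 (h₁ L hL m hm h hh p) (h₂ L hL m hm h hh p)
  | a6 a φ =>
    intro Mom lt M hM i
    rw [truth_imp]
    rintro H L hL m hm h ⟨_, k, hk, q, e⟩ p j hj
    exact H L hL j.mom (hm.trans ⟨_, j, rfl, rfl, hj⟩) j.hist
      ⟨j.mem, k, hk, q, (M.epi_equiv a).trans e hj⟩ j.mem
  | suN a φ =>
    intro Mom lt M hM i
    rw [truth_imp]
    intro H L hL m hm h hh p
    obtain ⟨h', q, e⟩ := hm.exists_epi i.mem
    exact H _ e h p
  | sOic a φ =>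
    intro Mom lt M hM i
    rw [truth_imp, truth_diam]
    intro H
    obtain ⟨L, hL⟩ := soptimal_nonempty hM a i
    obtain ⟨h, hh⟩ := M.choice_ne _ _ L hL.1
    have p := M.choice_sub _ _ L hL.1 h hh
    refine ⟨h, p, fun j hj => ?_⟩
    exact H L hL j.mom ⟨⟨i.mom, h, p⟩, j, rfl, rfl, hj⟩ j.hist ⟨j.mem, h, hh, _, hj⟩ j.mem
  | sCl a φ =>
    intro Mom lt M hM i
    rw [truth_imp]
    intro H j hj h' p' L hL m hm h hh p
    have hij : momRel M a i.mom j.mom := ⟨i, j, rfl, rfl, hj⟩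
    obtain ⟨L', hL', hc⟩ := exists_soptimal_counterpart hij.symm hL
    exact H L' hL' m (hij.trans hm) h (hc m ▸ hh) p
  | inN a φ =>
    intro Mom lt M hM i
    rw [truth_imp]
    refine fun H => ⟨_, M.tau_univ a i, exAnte_nonempty a i, ?_⟩
    rintro j ⟨h, p, e⟩
    have hij : momRel M a i.mom j.mom := ⟨i, ⟨j.mom, h, p⟩, rfl, rfl, e⟩
    obtain ⟨h', q, e'⟩ := hij.symm.exists_epi j.mem
    exact H h' q j ((M.epi_equiv a).symm e')
  | ki a φ =>
    intro Mom lt M hM i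
    rw [truth_imp]
    rintro ⟨U, hU, hUn, h⟩ h' p j hj
    have : M.tau a i = M.tau a j := tau_eq_of_momRel ⟨⟨i.mom, h', p⟩, j, rfl, rfl, hj⟩
    exact ⟨U, this ▸ hU, hUn, h⟩

end Soundness

/-! ### Maximal consistent theories -/

section Theories

/-- Three formulas as a substitution for the propositional variables. -/
def triple (φ ψ χ : Formula Agent) : ℕ → Formula Agent
  | 0 => φ
  | 1 => ψ
  | _ => χ

/-- Implication between propositional forms. -/
abbrev PropForm.imp (p q : PropForm) : PropForm := .neg (.conj p (.neg q))

theorem Lambda_R'.of_eval (f : PropForm → PropForm → PropForm → PropForm) (φ ψ χ : Formula Agent)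
    (hf : ∀ v, (f (.var 0) (.var 1) (.var 2)).eval v) :
    Lambda_R' ((f (.var 0) (.var 1) (.var 2)).toFormula (triple φ ψ χ)) :=
  .taut ⟨_, _, hf, rfl⟩

theorem Lambda_R'.imp_self (φ : Formula Agent) : Lambda_R' (φ.imp φ) :=
  of_eval (fun P _ _ => P.imp P) φ φ φ (by intro v; simp [PropForm.eval])

theorem Lambda_R'.imp_intro (φ ψ : Formula Agent) : Lambda_R' (φ.imp (ψ.imp φ)) :=
  of_eval (fun P Q _ => P.imp (Q.imp P)) φ ψ φ (by intro v; simp [PropForm.eval]; tauto)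

theorem Lambda_R'.imp_distrib (φ ψ χ : Formula Agent) :
    Lambda_R' ((φ.imp (ψ.imp χ)).imp ((φ.imp ψ).imp (φ.imp χ))) :=
  of_eval (fun P Q R => (P.imp (Q.imp R)).imp ((P.imp Q).imp (P.imp R))) φ ψ χ
    (by intro v; simp [PropForm.eval]; tauto)

theorem Lambda_R'.by_cases (φ ψ : Formula Agent) :
    Lambda_R' ((φ.imp ψ).imp ((φ.neg.imp ψ).imp ψ)) :=
  of_eval (fun P Q _ => (P.imp Q).imp ((P.neg.imp Q).imp Q)) φ ψ ψ
    (by intro v; simp [PropForm.eval]; tauto)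

theorem Lambda_R'.explosion (φ ψ : Formula Agent) : Lambda_R' (φ.imp (φ.neg.imp ψ)) :=
  of_eval (fun P Q _ => P.imp (P.neg.imp Q)) φ ψ ψ (by intro v; simp [PropForm.eval]; tauto)

theorem Lambda_R'.conj_left (φ ψ : Formula Agent) : Lambda_R' ((φ.conj ψ).imp φ) :=
  of_eval (fun P Q _ => (P.conj Q).imp P) φ ψ ψ (by intro v; simp [PropForm.eval]; tauto)

theorem Lambda_R'.conj_right (φ ψ : Formula Agent) : Lambda_R' ((φ.conj ψ).imp ψ) :=
  of_eval (fun P Q _ => (P.conj Q).imp Q) φ ψ ψ (by intro v; simp [PropForm.eval])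

theorem Lambda_R'.conj_intro (φ ψ : Formula Agent) :
    Lambda_R' (φ.imp (ψ.imp (φ.conj ψ))) :=
  of_eval (fun P Q _ => P.imp (Q.imp (P.conj Q))) φ ψ ψ (by intro v; simp [PropForm.eval]; tauto)

/-- A set of formulas that contains all theorems and is closed under modus ponens. -/
structure IsTheory (T : Set (Formula Agent)) : Prop where
  of_thm : ∀ {φ}, Lambda_R' φ → φ ∈ T
  mp : ∀ {φ ψ : Formula Agent}, φ.imp ψ ∈ T → φ ∈ T → ψ ∈ T

/-- A complete and consistent theory. -/
structure IsWorld (T : Set (Formula Agent)) : Prop extends IsTheory T where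
  neg_mem_iff : ∀ {φ : Formula Agent}, φ.neg ∈ T ↔ φ ∉ T

theorem isTheory_thms : IsTheory {φ : Formula Agent | Lambda_R' φ} :=
  ⟨id, Lambda_R'.mp⟩

theorem IsTheory.adjoin {T : Set (Formula Agent)} (hT : IsTheory T) (φ : Formula Agent) :
    IsTheory {ψ | φ.imp ψ ∈ T} where
  of_thm h := hT.mp (hT.of_thm (.imp_intro _ _)) (hT.of_thm h)
  mp h₁ h₂ := hT.mp (hT.mp (hT.of_thm (.imp_distrib _ _ _)) h₁) h₂

theorem IsTheory.isWorld_of_maximal {T : Set (Formula Agent)} {φ : Formula Agent}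
    (hT : IsTheory T) (hφ : φ ∉ T)
    (hmax : ∀ T', IsTheory T' → φ ∉ T' → T ⊆ T' → T' ⊆ T) : IsWorld T where
  toIsTheory := hT
  neg_mem_iff {ψ} := by
    have key : ∀ χ, χ ∉ T → χ.imp φ ∈ T := by
      intro χ hχ
      by_contra h
      exact hχ (hmax _ (hT.adjoin χ) h
        (fun θ hθ => hT.mp (hT.of_thm (.imp_intro _ _)) hθ) (hT.of_thm (.imp_self χ)))
    constructor
    · exact fun h h' => hφ (hT.mp (hT.mp (hT.of_thm (.explosion ψ φ)) h') h)
    · intro h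
      by_contra h'
      exact hφ (hT.mp (hT.mp (hT.of_thm (.by_cases ψ φ)) (key _ h)) (key _ h'))

/-- Lindenbaum's lemma. -/
theorem IsTheory.exists_isWorld {T : Set (Formula Agent)} (hT : IsTheory T) {φ : Formula Agent}
    (hφ : φ ∉ T) : ∃ w, IsWorld w ∧ T ⊆ w ∧ φ ∉ w := by
  obtain ⟨w, hTw, hw⟩ := zorn_subset_nonempty {T' | IsTheory T' ∧ φ ∉ T'} (by
    intro c hc hchain hne
    refine ⟨⋃₀ c, ⟨⟨fun h => ?_, ?_⟩, ?_⟩, fun s hs => Set.subset_sUnion_of_mem hs⟩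
    · obtain ⟨s, hs⟩ := hne
      exact ⟨s, hs, (hc hs).1.of_thm h⟩
    · rintro ψ χ ⟨s, hs, h₁⟩ ⟨t, ht, h₂⟩
      rcases hchain.total hs ht with h | h
      · exact ⟨t, ht, (hc ht).1.mp (h h₁) h₂⟩
      · exact ⟨s, hs, (hc hs).1.mp h₁ (h h₂)⟩
    · rintro ⟨s, hs, h⟩
      exact (hc hs).2 h) T ⟨hT, hφ⟩
  exact ⟨w, hw.prop.1.isWorld_of_maximal hw.prop.2 fun T' h h' hle => hw.le_of_ge ⟨h, h'⟩ hle,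
    hTw, hw.prop.2⟩

/-- The worlds of the canonical model. -/
def World (Agent : Type) : Type := {T : Set (Formula Agent) // IsWorld T}

instance : Membership (Formula Agent) (World Agent) := ⟨fun w φ => φ ∈ w.1⟩

theorem IsTheory.exists_world {T : Set (Formula Agent)} (hT : IsTheory T) {φ : Formula Agent}
    (hφ : φ ∉ T) : ∃ w : World Agent, (∀ ψ ∈ T, ψ ∈ w) ∧ φ ∉ w :=
  let ⟨w, hw, hTw, h⟩ := hT.exists_isWorld hφ
  ⟨⟨w, hw⟩, fun _ hψ => hTw hψ, h⟩

namespace World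

variable (w : World Agent) {φ ψ : Formula Agent}

theorem of_thm (h : Lambda_R' φ) : φ ∈ w := w.2.of_thm h

@[simp] theorem neg_mem : φ.neg ∈ w ↔ φ ∉ w := w.2.neg_mem_iff

@[simp] theorem conj_mem : φ.conj ψ ∈ w ↔ φ ∈ w ∧ ψ ∈ w :=
  ⟨fun h => ⟨w.2.mp (w.of_thm (.conj_left _ _)) h, w.2.mp (w.of_thm (.conj_right _ _)) h⟩,
    fun h => w.2.mp (w.2.mp (w.of_thm (.conj_intro _ _)) h.1) h.2⟩

@[simp] theorem imp_mem : φ.imp ψ ∈ w ↔ (φ ∈ w → ψ ∈ w) := by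
  simp [Formula.imp]

theorem of_imp (h : Lambda_R' (φ.imp ψ)) (hφ : φ ∈ w) : ψ ∈ w :=
  (imp_mem w).1 (w.of_thm h) hφ

theorem bigConj_mem (l : List (Formula Agent)) (φ : Formula Agent) :
    bigConj φ l ∈ w ↔ ∀ ψ ∈ φ :: l, ψ ∈ w := by
  induction l generalizing φ with
  | nil => simp [bigConj]
  | cons ψ l ih => simp only [bigConj, conj_mem, ih, List.forall_mem_cons]

end World

theorem Lambda_R'.of_forall_world {φ : Formula Agent} (h : ∀ w : World Agent, φ ∈ w) :
    Lambda_R' φ := by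
  by_contra hφ
  obtain ⟨w, -, hw⟩ := isTheory_thms.exists_world hφ
  exact hw (h w)

/-- A contradiction. -/
def Formula.bot : Formula Agent := .conj (.atom 0) (.neg (.atom 0))

@[simp] theorem World.bot_mem (w : World Agent) : Formula.bot ∉ w := by
  simp [Formula.bot]

/-! ### Normal operators -/

/-- An operator on formulas that satisfies the schema K and necessitation. -/
structure IsNormal (N : Formula Agent → Formula Agent) : Prop where
  k : ∀ φ ψ, Lambda_R' ((N (φ.imp ψ)).imp ((N φ).imp (N ψ)))
  nec : ∀ {φ}, Lambda_R' φ → Lambda_R' (N φ)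

namespace IsNormal

variable {N N₁ N₂ : Formula Agent → Formula Agent}

theorem mono (hN : IsNormal N) {φ ψ : Formula Agent}
    (h : ∀ v : World Agent, φ ∈ v → ψ ∈ v) {w : World Agent} (hw : N φ ∈ w) : N ψ ∈ w := by
  have : Lambda_R' (φ.imp ψ) := .of_forall_world fun v => (World.imp_mem v).2 (h v)
  exact (World.imp_mem w).1 (w.of_imp (hN.k φ ψ) (w.of_thm (hN.nec this))) hw

theorem isTheory (hN : IsNormal N) (w : World Agent) : IsTheory {φ | N φ ∈ w} where
  of_thm h := w.of_thm (hN.nec h)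
  mp h₁ h₂ := (World.imp_mem w).1 (w.of_imp (hN.k _ _) h₁) h₂

theorem exists_world (hN : IsNormal N) {w : World Agent} {φ : Formula Agent} (hφ : N φ ∉ w) :
    ∃ v : World Agent, (∀ ψ, N ψ ∈ w → ψ ∈ v) ∧ φ ∉ v :=
  (hN.isTheory w).exists_world hφ

/-- If the canonical relation of `N₁ ∘ N₂` links two worlds, then there is a world
between them. -/
theorem exists_between (h₁ : IsNormal N₁) (h₂ : IsNormal N₂) {w v : World Agent}
    (h : ∀ φ, N₁ (N₂ φ) ∈ w → φ ∈ v) :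
    ∃ u : World Agent, (∀ φ, N₁ φ ∈ w → φ ∈ u) ∧ ∀ φ, N₂ φ ∈ u → φ ∈ v := by
  have hT : IsTheory {θ | ∃ χ, χ ∉ v ∧ N₁ ((N₂ χ).neg.imp θ) ∈ w} := by
    refine ⟨fun {θ} hθ => ⟨.bot, World.bot_mem v, ?_⟩, ?_⟩
    · exact w.of_thm (h₁.nec (.mp (.imp_intro _ _) hθ))
    · rintro θ η ⟨χ₁, hχ₁, hw₁⟩ ⟨χ₂, hχ₂, hw₂⟩
      refine ⟨χ₁.neg.imp χ₂, by simp [hχ₁, hχ₂], ?_⟩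
      have hc : N₁ (.conj ((N₂ χ₁).neg.imp (θ.imp η)) ((N₂ χ₂).neg.imp θ)) ∈ w :=
        (World.imp_mem w).1 (w.of_imp (h₁.k _ _) (h₁.mono (fun x hx =>
          x.of_imp (.conj_intro _ _) hx) hw₁)) hw₂
      refine h₁.mono (fun x hx => ?_) hc
      simp only [World.conj_mem, World.imp_mem, World.neg_mem] at hx ⊢
      intro hn
      have n₁ : N₂ χ₁ ∉ x := fun hx₁ => hn (h₂.mono (fun y hy => by simp [hy]) hx₁)
      have n₂ : N₂ χ₂ ∉ x := fun hx₂ => hn (h₂.mono (fun y hy => by simp [hy]) hx₂)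
      exact hx.1 n₁ (hx.2 n₂)
  have hbot : Formula.bot ∉ {θ | ∃ χ, χ ∉ v ∧ N₁ ((N₂ χ).neg.imp θ) ∈ w} := by
    rintro ⟨χ, hχ, hw⟩
    refine hχ (h χ (h₁.mono (fun x hx => ?_) hw))
    simpa using hx
  obtain ⟨u, hu, -⟩ := hT.exists_world hbot
  refine ⟨u, fun φ hφ => hu φ ⟨.bot, World.bot_mem v, h₁.mono (fun x hx => by simp [hx]) hφ⟩, ?_⟩
  intro φ hφ
  by_contra hv
  have : (N₂ φ).neg ∈ u := hu _ ⟨φ, hv, w.of_thm (h₁.nec (.imp_self _))⟩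
  exact (World.neg_mem u).1 this hφ

end IsNormal

/-- An operator on formulas that satisfies the `S5` schemata. -/
structure IsS5 (N : Formula Agent → Formula Agent) : Prop extends IsNormal N where
  t : ∀ φ, Lambda_R' ((N φ).imp φ)
  five : ∀ φ : Formula Agent, Lambda_R' ((Formula.neg (N φ.neg)).imp (N (Formula.neg (N φ.neg))))

namespace IsS5

variable {N : Formula Agent → Formula Agent}

theorem mem_of_mem (hN : IsS5 N) {w : World Agent} {φ : Formula Agent} (h : N φ ∈ w) : φ ∈ w :=
  w.of_imp (hN.t φ) h

theorem neg_introspection (hN : IsS5 N) {w : World Agent} {φ : Formula Agent} (h : N φ ∉ w) :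
    N (N φ).neg ∈ w := by
  have h' : (N φ.neg.neg).neg ∈ w :=
    (World.neg_mem w).2 fun h' => h (hN.mono (fun x hx => by simpa using hx) h')
  refine hN.mono (fun x hx => ?_) (w.of_imp (hN.five φ.neg) h')
  exact (World.neg_mem x).2 fun hx' =>
    (World.neg_mem x).1 hx (hN.mono (fun y hy => by simpa using hy) hx')

theorem pos_introspection (hN : IsS5 N) {w : World Agent} {φ : Formula Agent} (h : N φ ∈ w) :
    N (N φ) ∈ w := by
  have h' : (N (N φ).neg).neg ∈ w :=
    (World.neg_mem w).2 fun h' => (World.neg_mem w).1 (hN.mem_of_mem h') h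
  refine hN.mono (fun x hx => ?_) (w.of_imp (hN.five (N φ)) h')
  by_contra hx'
  exact (World.neg_mem x).1 hx (hN.neg_introspection hx')

end IsS5

/-- The relation of containing the same formulas of the form `N φ`. -/
def SameN (N : Formula Agent → Formula Agent) (w v : World Agent) : Prop :=
  ∀ φ, N φ ∈ w ↔ N φ ∈ v

theorem SameN.symm {N : Formula Agent → Formula Agent} {w v : World Agent} (h : SameN N w v) :
    SameN N v w := fun φ => (h φ).symm

theorem SameN.trans {N : Formula Agent → Formula Agent} {w v u : World Agent} (h : SameN N w v)
    (h' : SameN N v u) : SameN N w u := fun φ => (h φ).trans (h' φ)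

namespace IsS5

variable {N : Formula Agent → Formula Agent}

theorem sameN (hN : IsS5 N) {w v : World Agent} (h : ∀ φ, N φ ∈ w → φ ∈ v) : SameN N w v := by
  refine fun φ => ⟨fun hw => h _ (hN.pos_introspection hw), fun hv => ?_⟩
  by_contra hw
  exact (World.neg_mem v).1 (h _ (hN.neg_introspection hw)) hv

theorem mem_of_sameN (hN : IsS5 N) {w v : World Agent} (h : SameN N w v) {φ : Formula Agent}
    (hw : N φ ∈ w) : φ ∈ v :=
  hN.mem_of_mem ((h φ).1 hw)

theorem exists_sameN (hN : IsS5 N) {w : World Agent} {φ : Formula Agent} (hφ : N φ ∉ w) :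
    ∃ v, SameN N w v ∧ φ ∉ v :=
  let ⟨v, hv, h⟩ := hN.exists_world hφ
  ⟨v, hN.sameN hv, h⟩

end IsS5

theorem isS5_box : IsS5 (Formula.box : Formula Agent → Formula Agent) where
  k := .boxK
  nec := .necBox
  t := .boxT
  five := .box5

theorem isS5_stit (a : Agent) : IsS5 (Formula.stit a) where
  k := .stitK a
  nec := .necStit a
  t := .stitT a
  five := .stit5 a

theorem isS5_know (a : Agent) : IsS5 (Formula.know a) where
  k := .knowK a
  nec := .necKnow a
  t := .knowT a
  five := .know5 a

theorem isNormal_intend (a : Agent) : IsNormal (Formula.intend a) := ⟨.intK a, .necInt a⟩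

theorem isNormal_oughtO (a : Agent) : IsNormal (Formula.oughtO a) := ⟨.a1 a, .necOO a⟩

theorem isNormal_oughtS (a : Agent) : IsNormal (Formula.oughtS a) := ⟨.a5 a, .necOS a⟩

/-! ### The canonical relations -/

/-- Historical equivalence of worlds. -/
abbrev SameMoment (w v : World Agent) : Prop := SameN Formula.box w v

theorem SameN.stit_of_know {a : Agent} {w v : World Agent} (h : SameN (Formula.stit a) w v) :
    SameN (Formula.know a) w v :=
  (isS5_know a).sameN fun _ hφ => (isS5_know a).mem_of_mem ((isS5_stit a).mem_of_sameN h
    (w.of_imp (.oac a _) ((isS5_know a).pos_introspection hφ)))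

theorem SameN.moment_of_stit {a : Agent} {w v : World Agent} (h : SameN (Formula.stit a) w v) :
    SameMoment w v :=
  isS5_box.sameN fun _ hφ => isS5_box.mem_of_mem ((isS5_stit a).mem_of_sameN h
    (w.of_imp (.set a _) (isS5_box.pos_introspection hφ)))

theorem oughtO_mem_iff {a : Agent} {w v : World Agent} (h : SameMoment w v) (φ : Formula Agent) :
    Formula.oughtO a φ ∈ w ↔ Formula.oughtO a φ ∈ v :=
  ⟨fun hw => isS5_box.mem_of_sameN h (w.of_imp (.a3 a φ) hw),
    fun hv => isS5_box.mem_of_sameN h.symm (v.of_imp (.a3 a φ) hv)⟩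

theorem oughtS_mem_of_know {a : Agent} {w v : World Agent} (h : SameN (Formula.know a) w v)
    {φ : Formula Agent} (hw : Formula.oughtS a φ ∈ w) : Formula.oughtS a φ ∈ v :=
  isS5_box.mem_of_mem ((isS5_know a).mem_of_sameN h (w.of_imp (.sCl a φ) hw))

theorem oughtS_mem_of_moment {a : Agent} {w v : World Agent} (h : SameMoment w v)
    {φ : Formula Agent} (hw : Formula.oughtS a φ ∈ w) : Formula.oughtS a φ ∈ v :=
  isS5_box.mem_of_sameN h ((isS5_know a).mem_of_mem (w.of_imp (.sCl a φ) hw))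

theorem intend_mem_of_moment {a : Agent} {w v : World Agent} (h : SameMoment w v)
    {φ : Formula Agent} (hw : Formula.intend a φ ∈ w) : Formula.intend a φ ∈ v :=
  (isS5_know a).mem_of_mem (isS5_box.mem_of_sameN h (w.of_imp (.ki a φ) hw))

theorem intend_mem_of_know {a : Agent} {w v : World Agent} (h : SameN (Formula.know a) w v)
    {φ : Formula Agent} (hw : Formula.intend a φ ∈ w) : Formula.intend a φ ∈ v :=
  (isS5_know a).mem_of_sameN h (isS5_box.mem_of_mem (w.of_imp (.ki a φ) hw))

/-- Uniformity of historical possibility in the canonical model. -/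
theorem exists_know_moment {a : Agent} {w v w' : World Agent} (h : SameN (Formula.know a) w v)
    (h' : SameMoment w w') : ∃ v', SameMoment v v' ∧ SameN (Formula.know a) w' v' := by
  obtain ⟨u, hu, hu'⟩ := isS5_box.exists_between (isS5_know a).toIsNormal (w := v) (v := w') (by
    intro φ hφ
    by_contra hw'
    have h₁ := (isS5_know a).neg_introspection fun hk => hw' ((isS5_know a).mem_of_mem hk)
    have h₂ : Formula.diam (.know a (.neg (.know a φ))) ∈ w := (World.neg_mem w).2 fun hb =>
      (World.neg_mem w').1 (isS5_box.mem_of_sameN h' hb) h₁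
    have h₃ := (isS5_know a).mem_of_sameN h (w.of_imp (.unifH a _) h₂)
    exact (World.neg_mem v).1 h₃ (isS5_box.mono (fun x hx => by simpa using hx) hφ))
  exact ⟨u, isS5_box.sameN hu, ((isS5_know a).sameN hu').symm⟩

/-- Independence of agents in the canonical model. -/
theorem exists_sameN_stit [Finite Agent] (w : World Agent) (f : Agent → World Agent)
    (hf : ∀ a, SameMoment w (f a)) :
    ∃ v, SameMoment w v ∧ ∀ a, SameN (Formula.stit a) (f a) v := by
  classical
  have := Fintype.ofFinite Agent
  cases isEmpty_or_nonempty Agent with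
  | inl h => exact ⟨w, fun _ => Iff.rfl, fun a => isEmptyElim a⟩
  | inr h =>
    obtain ⟨a₀⟩ := id h
    let T : Set (Formula Agent) := {χ | ∃ g : Agent → Formula Agent,
      (∀ a, Formula.stit a (g a) ∈ f a) ∧
        ∀ v : World Agent, (∀ a, Formula.stit a (g a) ∈ v) → χ ∈ v}
    have hT : IsTheory T := by
      refine ⟨fun {χ} h => ⟨fun _ => χ, fun a => (f a).of_thm (.necStit a h),
        fun v _ => v.of_thm h⟩, ?_⟩
      rintro χ θ ⟨g₁, h₁, k₁⟩ ⟨g₂, h₂, k₂⟩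
      refine ⟨fun a => (g₁ a).conj (g₂ a), fun a => ?_, fun v hv => ?_⟩
      · exact ((isS5_stit a).isTheory (f a)).mp (((isS5_stit a).isTheory (f a)).mp
          (((isS5_stit a).isTheory (f a)).of_thm (.conj_intro _ _)) (h₁ a)) (h₂ a)
      · exact (World.imp_mem v).1
          (k₁ v fun a => (isS5_stit a).mono (fun x hx => ((World.conj_mem x).1 hx).1) (hv a))
          (k₂ v fun a => (isS5_stit a).mono (fun x hx => ((World.conj_mem x).1 hx).2) (hv a))
    have hbot : Formula.bot ∉ T := by
      rintro ⟨g, hg, k⟩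
      have hmem : ∀ a, (a, g a) ∈ (Finset.univ.toList : List Agent).map fun a => (a, g a) :=
        fun a => List.mem_map.2 ⟨a, by simp, rfl⟩
      have hnodup : (((Finset.univ.toList : List Agent).map fun a => (a, g a)).map
          Prod.fst).Nodup := by
        simpa [Function.comp_def] using Finset.nodup_toList (Finset.univ : Finset Agent)
      have hfst : ∀ q ∈ (Finset.univ.toList : List Agent).map fun a => (a, g a),
          q.2 = g q.1 := by
        intro q hq
        obtain ⟨a, -, rfl⟩ := List.mem_map.1 hq
        rfl
      generalize (Finset.univ.toList : List Agent).map (fun a => (a, g a)) = l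
        at hmem hnodup hfst
      cases l with
      | nil => exact absurd (hmem a₀) (by simp)
      | cons p l =>
        have hdiam : ∀ q ∈ p :: l, Formula.diam (.stit q.1 q.2) ∈ w := fun q hq =>
          (World.neg_mem w).2 fun hb => (World.neg_mem (f q.1)).1
            (isS5_box.mem_of_sameN (hf q.1) hb) (hfst q hq ▸ hg q.1)
        have h₁ := w.of_imp (.indep p l hnodup) ((World.bigConj_mem w _ _).2 (by
          intro ψ hψ
          rcases List.mem_cons.1 hψ with rfl | hψ
          · exact hdiam p List.mem_cons_self
          · obtain ⟨q, hq, rfl⟩ := List.mem_map.1 hψ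
            exact hdiam q (List.mem_cons_of_mem _ hq)))
        refine (World.neg_mem w).1 h₁ (w.of_thm (.necBox (.of_forall_world fun v => ?_)))
        rw [World.neg_mem, World.bigConj_mem]
        intro hv
        refine World.bot_mem v (k v fun a => ?_)
        rcases List.mem_cons.1 (hmem a) with h | h
        · exact hv _ (List.mem_cons.2 (.inl (by rw [← h])))
        · exact hv _ (List.mem_cons_of_mem _ (List.mem_map.2 ⟨_, h, rfl⟩))
    obtain ⟨v, hv, -⟩ := hT.exists_world hbot
    have hs : ∀ a, SameN (Formula.stit a) (f a) v := by
      intro a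
      refine (isS5_stit a).sameN fun χ hχ => hv χ
        ⟨Function.update (fun _ => Formula.bot.neg) a χ, fun b => ?_, fun u hu => ?_⟩
      · by_cases hb : b = a
        · subst hb; simpa using hχ
        · rw [Function.update_of_ne hb]
          exact (f b).of_thm (.necStit b (.of_forall_world fun x => by simp))
      · have := hu a
        rw [Function.update_self] at this
        exact (isS5_stit a).mem_of_mem this
    exact ⟨v, (hf a₀).trans (hs a₀).moment_of_stit, hs⟩

/-- Worlds compatible with an agent's objective obligations see them fulfilled. -/
theorem exists_oughtO {a : Agent} {w : World Agent} {φ : Formula Agent}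
    (hφ : Formula.oughtO a φ ∉ w) : ∃ v, SameMoment w v ∧
      (∀ ψ, Formula.oughtO a ψ ∈ v → Formula.stit a ψ ∈ v) ∧ φ ∉ v := by
  obtain ⟨v, hv, hv'⟩ := (isNormal_oughtO a).exists_world hφ
  have hwv : SameMoment w v := isS5_box.sameN fun ψ hψ => hv ψ (w.of_imp (.a2 a ψ) hψ)
  exact ⟨v, hwv, fun ψ hψ => hv _ (w.of_imp (.a4 a ψ) ((oughtO_mem_iff hwv ψ).2 hψ)), hv'⟩

theorem oughtO_bot (a : Agent) (w : World Agent) : Formula.oughtO a Formula.bot ∉ w := fun h =>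
  (World.neg_mem w).1 (w.of_imp (.oic a _) h) (w.of_thm (.necBox (.of_forall_world fun v =>
    (World.neg_mem v).2 fun h' => World.bot_mem v ((isS5_stit a).mem_of_mem h'))))

/-- Worlds compatible with an agent's subjective obligations see them knowingly fulfilled. -/
theorem exists_oughtS {a : Agent} {w : World Agent} {φ : Formula Agent}
    (hφ : Formula.oughtS a φ ∉ w) : ∃ u v, SameMoment w u ∧ SameN (Formula.know a) u v ∧
      (∀ ψ, Formula.oughtS a ψ ∈ v → Formula.know a ψ ∈ v) ∧ φ ∉ v := by
  obtain ⟨v, hv, hv'⟩ := (isNormal_oughtS a).exists_world hφ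
  obtain ⟨x, hx, hx'⟩ := (isS5_know a).exists_between isS5_box.toIsNormal (w := w) (v := v)
    fun ψ hψ => hv ψ (w.of_imp (.suN a ψ) hψ)
  have hwx := (isS5_know a).sameN hx
  have hxv := isS5_box.sameN hx'
  obtain ⟨u, hu, hu'⟩ := exists_know_moment hwx.symm hxv
  refine ⟨u, v, hu, hu'.symm, fun ψ hψ => hv _ (w.of_imp (.a6 a ψ) ?_), hv'⟩
  exact oughtS_mem_of_know hwx.symm (oughtS_mem_of_moment hxv.symm hψ)

theorem oughtS_bot (a : Agent) (w : World Agent) : Formula.oughtS a Formula.bot ∉ w := fun h =>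
  (World.neg_mem w).1 (w.of_imp (.sOic a _) h) (w.of_thm (.necBox (.of_forall_world fun v =>
    (World.neg_mem v).2 fun h' => World.bot_mem v ((isS5_know a).mem_of_mem h'))))

/-- Worlds compatible with an agent's intentions see them realized. -/
theorem exists_intend {a : Agent} {w : World Agent} {φ : Formula Agent}
    (hφ : Formula.intend a φ ∉ w) : ∃ u v, SameN (Formula.know a) w u ∧ SameMoment u v ∧
      (∀ ψ, Formula.intend a ψ ∈ v → ψ ∈ v) ∧ φ ∉ v := by
  obtain ⟨v, hv, hv'⟩ := (isNormal_intend a).exists_world hφ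
  obtain ⟨x, hx, hx'⟩ := isS5_box.exists_between (isS5_know a).toIsNormal (w := w) (v := v)
    fun ψ hψ => hv ψ (w.of_imp (.inN a ψ) hψ)
  have hwx := isS5_box.sameN hx
  have hxv := (isS5_know a).sameN hx'
  obtain ⟨u, hu, hu'⟩ := exists_know_moment hxv hwx.symm
  refine ⟨u, v, hu', hu.symm, fun ψ hψ => hv _ ?_, hv'⟩
  exact intend_mem_of_moment hwx.symm (intend_mem_of_know hxv.symm hψ)

theorem intend_bot (a : Agent) (w : World Agent) : Formula.intend a Formula.bot ∉ w := fun h =>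
  (World.neg_mem w).1 (w.of_imp (.intD a _) h)
    (w.of_thm (.necInt a (.of_forall_world fun v => by simp)))

end Theories

/-! ### Models from indexed frames -/

/-- A Kripke-style frame for the language. The worlds fall into classes (the fibres of `cls`),
each agent partitions every class by a finite labelling `lab`, and knowledge is sameness of the
invariant `info`. -/
structure LabelledFrame (Agent : Type) where
  World : Type
  Cls : Type
  Lab : Type
  Info : Type
  ne : Nonempty World
  cls : World → Cls
  cls_surj : cls.Surjective
  lab : Agent → World → Lab
  lab_fin : ∀ a, (Set.range (lab a)).Finite
  info : Agent → World → Info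
  indep : ∀ w (f : Agent → World), (∀ a, cls (f a) = cls w) →
    ∃ v, cls v = cls w ∧ ∀ a, lab a v = lab a (f a)
  info_congr : ∀ {a w v}, cls w = cls v → lab a w = lab a v → info a w = info a v
  unif : ∀ {a w v w'}, info a w = info a v → cls w' = cls w →
    ∃ v', cls v' = cls v ∧ info a w' = info a v'
  goodO : Agent → World → Prop
  goodO_congr : ∀ {a w v}, cls w = cls v → lab a w = lab a v → goodO a w → goodO a v
  exists_goodO : ∀ a w, ∃ v, cls v = cls w ∧ goodO a v
  goodS : Agent → World → Prop
  goodS_congr : ∀ {a w v}, info a w = info a v → goodS a w → goodS a v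
  exists_goodS : ∀ a w, ∃ v, cls v = cls w ∧ goodS a v
  core : Agent → World → Prop
  exists_core : ∀ a w, ∃ v u, cls u = cls v ∧ info a w = info a u ∧ core a v
  val : ℕ → Set World

namespace LabelledFrame

variable (F : LabelledFrame Agent)

/-- Truth at a world of a labelled frame. -/
def sat : Formula Agent → F.World → Prop
  | .atom n, w => w ∈ F.val n
  | .neg φ, w => ¬ sat φ w
  | .conj φ ψ, w => sat φ w ∧ sat ψ w
  | .box φ, w => ∀ v, F.cls v = F.cls w → sat φ v
  | .stit a φ, w => ∀ v, F.cls v = F.cls w → F.lab a v = F.lab a w → sat φ v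
  | .know a φ, w => ∀ v, F.info a w = F.info a v → sat φ v
  | .intend a φ, w => ∀ v u, F.cls u = F.cls v → F.info a w = F.info a u → F.core a v → sat φ v
  | .oughtO a φ, w => ∀ v, F.cls v = F.cls w → F.goodO a v → sat φ v
  | .oughtS a φ, w => ∀ v u, F.cls u = F.cls w → F.info a u = F.info a v → F.goodS a v → sat φ v

/-- Every class is a moment, followed by one moment for each of its worlds. -/
def prec : F.Cls ⊕ F.World → F.Cls ⊕ F.World → Prop
  | .inl c, .inr w => F.cls w = c
  | _, _ => False

variable {F}

theorem prec_iff {m m' : F.Cls ⊕ F.World} :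
    F.prec m m' ↔ ∃ w, m = .inl (F.cls w) ∧ m' = .inr w := by
  rcases m with c | w <;> rcases m' with c' | w' <;> simp [prec, eq_comm]

theorem isChain_pair (w : F.World) :
    IsChain F.prec {Sum.inl (F.cls w), Sum.inr w} := by
  rintro x (rfl | rfl) y (rfl | rfl) h
  · exact absurd rfl h
  · exact .inl rfl
  · exact .inr rfl
  · exact absurd rfl h

theorem subset_pair {s : Set (F.Cls ⊕ F.World)} (hs : IsChain F.prec s) {w : F.World}
    (hw : Sum.inr w ∈ s) : s ⊆ {Sum.inl (F.cls w), Sum.inr w} := by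
  intro x hx
  by_cases h : x = Sum.inr w
  · exact .inr h
  · rcases hs hx hw h with h | h
    · obtain ⟨v, rfl, hv⟩ := prec_iff.1 h
      obtain rfl := Sum.inr_injective hv
      exact .inl rfl
    · obtain ⟨v, hv, -⟩ := prec_iff.1 h
      cases hv

variable (F) in
/-- The history through a world. -/
def hist (w : F.World) : Hist F.prec :=
  ⟨{Sum.inl (F.cls w), Sum.inr w}, isChain_pair w, fun _ ht hst =>
    hst.antisymm (subset_pair ht (hst (.inr rfl)))⟩

theorem exists_hist_eq (h : Hist F.prec) : ∃ w, F.hist w = h := by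
  have key : ∀ w, h.val ⊆ {Sum.inl (F.cls w), Sum.inr w} → F.hist w = h := fun w hw =>
    Subtype.ext (h.2.2 (isChain_pair w) hw).symm
  by_cases hr : ∃ w, Sum.inr w ∈ h.val
  · obtain ⟨w, hw⟩ := hr
    exact ⟨w, key w (subset_pair h.2.1 hw)⟩
  · by_cases hl : ∃ c, Sum.inl c ∈ h.val
    · obtain ⟨c, hc⟩ := hl
      obtain ⟨w, rfl⟩ := F.cls_surj c
      refine ⟨w, key w fun x hx => ?_⟩
      by_contra hne
      rcases h.2.1 hx hc (fun e => hne (.inl e)) with h' | h'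
      · obtain ⟨v, -, hv⟩ := prec_iff.1 h'
        cases hv
      · obtain ⟨v, -, rfl⟩ := prec_iff.1 h'
        exact hr ⟨v, hx⟩
    · obtain ⟨w⟩ := F.ne
      refine ⟨w, key w fun x hx => ?_⟩
      rcases x with c | v
      · exact absurd ⟨c, hx⟩ hl
      · exact absurd ⟨v, hx⟩ hr

@[simp] theorem inl_mem_hist {c : F.Cls} {w : F.World} :
    Sum.inl c ∈ (F.hist w).val ↔ F.cls w = c := by
  simp [hist, eq_comm]

@[simp] theorem inr_mem_hist {v w : F.World} : Sum.inr v ∈ (F.hist w).val ↔ w = v := by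
  simp [hist, eq_comm]

/-- The world that a history leads to. -/
noncomputable def endpoint (h : Hist F.prec) : F.World := (exists_hist_eq h).choose

@[simp] theorem endpoint_hist (w : F.World) : endpoint (F.hist w) = w := by
  have h : F.hist (endpoint (F.hist w)) = F.hist w := (exists_hist_eq _).choose_spec
  have h' : Sum.inr (endpoint (F.hist w)) ∈ (F.hist (endpoint (F.hist w))).val :=
    inr_mem_hist.2 rfl
  rw [h] at h'
  exact (inr_mem_hist.1 h').symm

variable (F) in
/-- The index at which a world is represented. -/
def idx (w : F.World) : Idx F.prec := ⟨.inl (F.cls w), F.hist w, inl_mem_hist.2 rfl⟩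

variable (F) in
/-- The index at the last moment of the history through a world. -/
def leaf (w : F.World) : Idx F.prec := ⟨.inr w, F.hist w, inr_mem_hist.2 rfl⟩

theorem mk_inl {c : F.Cls} {w : F.World} (p : Sum.inl c ∈ (F.hist w).val) :
    (⟨.inl c, F.hist w, p⟩ : Idx F.prec) = F.idx w := by
  obtain rfl := inl_mem_hist.1 p
  rfl

theorem idx_mom_mem_hist {v w : F.World} :
    (F.idx w).mom ∈ (F.hist v).val ↔ F.cls v = F.cls w :=
  inl_mem_hist

theorem mk_idx_mom {v w : F.World} (p : (F.idx w).mom ∈ (F.hist v).val) :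
    (⟨(F.idx w).mom, F.hist v, p⟩ : Idx F.prec) = F.idx v :=
  mk_inl p

theorem mk_inr {v w : F.World} (p : Sum.inr v ∈ (F.hist w).val) :
    (⟨.inr v, F.hist w, p⟩ : Idx F.prec) = F.leaf w := by
  obtain rfl := inr_mem_hist.1 p
  rfl

theorem idx_or_leaf (i : Idx F.prec) : (∃ w, i = F.idx w) ∨ ∃ w, i = F.leaf w := by
  obtain ⟨m, h, p⟩ := i
  obtain ⟨w, rfl⟩ := exists_hist_eq h
  rcases m with c | v
  · exact .inl ⟨w, mk_inl p⟩
  · exact .inr ⟨w, mk_inr p⟩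

/-- The label of an agent's choice along a history at a moment. -/
noncomputable def choiceLab (a : Agent) : F.Cls ⊕ F.World → Hist F.prec → Option F.Lab
  | .inl _, h => some (F.lab a (endpoint h))
  | .inr _, _ => none

/-- The cell of an agent's choice partition at a moment that contains a given history. -/
def cell (a : Agent) (m : F.Cls ⊕ F.World) (h : Hist F.prec) : Set (Hist F.prec) :=
  {h' | m ∈ h'.val ∧ choiceLab a m h' = choiceLab a m h}

/-- The information of an agent at an index. -/
noncomputable def infoKey (a : Agent) (i : Idx F.prec) : F.Info ⊕ F.World :=
  match i.mom with
  | .inl _ => .inl (F.info a (endpoint i.hist))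
  | .inr w => .inr w

/-- The indices that belong to every nonempty open set of an agent's topologies. -/
def coreIdx (a : Agent) (i : Idx F.prec) : Prop :=
  match i.mom with
  | .inl _ => F.core a (endpoint i.hist)
  | .inr _ => True

@[simp] theorem infoKey_idx (a : Agent) (w : F.World) :
    infoKey a (F.idx w) = .inl (F.info a w) := by simp [infoKey, idx]

@[simp] theorem coreIdx_idx (a : Agent) (w : F.World) :
    coreIdx a (F.idx w) ↔ F.core a w := by simp [coreIdx, idx]

variable (F) in
/-- The indices that an agent cannot distinguish. -/
def epi (a : Agent) (i j : Idx F.prec) : Prop := infoKey a i = infoKey a j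

theorem epi_idx {a : Agent} {w v : F.World} :
    F.epi a (F.idx w) (F.idx v) ↔ F.info a w = F.info a v := by
  simp [epi, Sum.inl_injective.eq_iff]

theorem mem_cell_inl {a : Agent} {c : F.Cls} {w v : F.World} :
    F.hist v ∈ cell a (.inl c) (F.hist w) ↔ F.cls v = c ∧ F.lab a v = F.lab a w := by
  simp [cell, choiceLab]

theorem epi_of_mem_cell {a : Agent} {i : Idx F.prec} {h : Hist F.prec}
    (hh : h ∈ cell a i.mom i.hist) (p : i.mom ∈ h.val) : F.epi a ⟨i.mom, h, p⟩ i := by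
  obtain ⟨v, rfl⟩ := exists_hist_eq h
  rcases idx_or_leaf i with ⟨w, rfl⟩ | ⟨w, rfl⟩
  · have hh := mem_cell_inl.1 hh
    rw [mk_idx_mom, epi_idx]
    exact F.info_congr hh.1 hh.2
  · rfl

theorem exists_epi_of_epi {a : Agent} {i j : Idx F.prec} (e : F.epi a i j) (h : Hist F.prec)
    (p : i.mom ∈ h.val) :
    ∃ (h' : Hist F.prec) (q : j.mom ∈ h'.val), F.epi a ⟨i.mom, h, p⟩ ⟨j.mom, h', q⟩ := by
  obtain ⟨w', rfl⟩ := exists_hist_eq h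
  rcases idx_or_leaf i with ⟨w, rfl⟩ | ⟨w, rfl⟩ <;> rcases idx_or_leaf j with ⟨v, rfl⟩ | ⟨v, rfl⟩
  · obtain ⟨v', hv, he⟩ := F.unif (epi_idx.1 e) (inl_mem_hist.1 p)
    refine ⟨F.hist v', idx_mom_mem_hist.2 hv, ?_⟩
    rw [mk_idx_mom, mk_idx_mom, epi_idx]
    exact he
  · cases e
  · cases e
  · obtain rfl := Sum.inr_injective e
    exact ⟨_, p, rfl⟩

theorem exists_coreIdx (a : Agent) (i : Idx F.prec) : ∃ j ∈ exAnte F.epi a i, coreIdx a j := by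
  rcases idx_or_leaf i with ⟨w, rfl⟩ | ⟨w, rfl⟩
  · obtain ⟨v, u, huv, hu, hv⟩ := F.exists_core a w
    refine ⟨F.idx v, ⟨F.hist u, idx_mom_mem_hist.2 huv, ?_⟩, by simpa using hv⟩
    rw [mk_idx_mom, epi_idx]
    exact hu
  · exact ⟨F.leaf w, ⟨F.hist w, _, rfl⟩, trivial⟩

open Classical in
/-- The value of a history is `1` if all agents are in a good position along it. -/
noncomputable def value (g : Agent → F.World → Prop) (h : Hist F.prec) : ℝ :=
  if ∀ a, g a (endpoint h) then 1 else 0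

theorem exists_inter_cell (m : F.Cls ⊕ F.World) (f : Agent → Hist F.prec)
    (hf : ∀ a, m ∈ (f a).val) : ∃ h : Hist F.prec, m ∈ h.val ∧ ∀ a, h ∈ cell a m (f a) := by
  rcases m with c | w
  · obtain ⟨w, rfl⟩ := F.cls_surj c
    choose g hg using fun a => exists_hist_eq (f a)
    obtain rfl : (fun a => F.hist (g a)) = f := funext hg
    obtain ⟨v, hv, hl⟩ := F.indep w g fun a => inl_mem_hist.1 (hf a)
    exact ⟨F.hist v, inl_mem_hist.2 hv, fun a => mem_cell_inl.2 ⟨hv, hl a⟩⟩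
  · exact ⟨F.hist w, inr_mem_hist.2 rfl, fun a => ⟨inr_mem_hist.2 rfl, rfl⟩⟩

variable (F) in
/-- The bi-valued model built from a labelled frame. -/
noncomputable def model [Finite Agent] : BiKiobtModel Agent (F.Cls ⊕ F.World) F.prec where
  ags_fin := inferInstance
  mom_ne := F.ne.map .inr
  lt_irrefl m h := by
    obtain ⟨w, rfl, h⟩ := prec_iff.1 h
    cases h
  lt_trans h h' := by
    obtain ⟨w, rfl, rfl⟩ := prec_iff.1 h
    obtain ⟨v, h, -⟩ := prec_iff.1 h'
    cases h
  no_bb h h' := by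
    obtain ⟨w, rfl, rfl⟩ := prec_iff.1 h
    obtain ⟨v, rfl, h⟩ := prec_iff.1 h'
    obtain rfl := Sum.inr_injective h
    exact .inl rfl
  Choice a m := {L | ∃ h : Hist F.prec, m ∈ h.val ∧ L = cell a m h}
  choice_sub := by
    rintro a m _ ⟨h, hm, rfl⟩ h' hh'
    exact hh'.1
  choice_ne := by
    rintro a m _ ⟨h, hm, rfl⟩
    exact ⟨h, hm, rfl⟩
  choice_cover a m h hm := ⟨cell a m h, ⟨h, hm, rfl⟩, hm, rfl⟩
  choice_disj := by
    rintro a m _ ⟨h₁, -, rfl⟩ _ ⟨h₂, -, rfl⟩ h hh₁ hh₂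
    simp only [cell, ← hh₁.2, ← hh₂.2]
  nc := by
    rintro a m m' hlt h h' _ _ hm hm' _ _ hL
    obtain ⟨w, rfl, rfl⟩ := prec_iff.1 hlt
    obtain ⟨v, rfl⟩ := exists_hist_eq h
    obtain ⟨v', rfl⟩ := exists_hist_eq h'
    obtain rfl := inr_mem_hist.1 hm
    obtain rfl := inr_mem_hist.1 hm'
    exact hL
  ia := by
    intro m s hs
    choose f hf hfs using hs
    obtain ⟨h, -, hh⟩ := exists_inter_cell m f hf
    exact ⟨h, Set.mem_iInter.2 fun a => hfs a ▸ hh a⟩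
  epi := F.epi
  epi_equiv a := ⟨fun _ => rfl, fun h => h.symm, fun h h' => h.trans h'⟩
  oac := by
    rintro a i j e _ ⟨h₀, -, rfl⟩ hi h' hh' p
    exact (epi_of_mem_cell (i := i) ⟨hh'.1, hh'.2.trans hi.2.symm⟩ p).trans e
  unifH a i j e h p := exists_epi_of_epi e h p
  tau a i := {U | U ⊆ exAnte F.epi a i ∧
    (U.Nonempty → ∀ j ∈ exAnte F.epi a i, coreIdx a j → j ∈ U)}
  tau_sub a i U hU := hU.1
  tau_univ a i := ⟨subset_rfl, fun _ j hj _ => hj⟩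
  tau_empty a i := ⟨Set.empty_subset _, fun h => absurd h Set.not_nonempty_empty⟩
  tau_inter a i U V hU hV := ⟨Set.inter_subset_left.trans hU.1,
    fun h j hj hc => ⟨hU.2 h.left j hj hc, hV.2 h.right j hj hc⟩⟩
  tau_sUnion a i S hS := by
    refine ⟨Set.sUnion_subset fun U hU => (hS hU).1, ?_⟩
    rintro ⟨k, U, hU, hk⟩ j hj hc
    exact ⟨U, hU, (hS hU).2 ⟨k, hk⟩ j hj hc⟩
  tau_ci a i U V hU hV hUn hVn := by
    obtain ⟨j, hj, hc⟩ := exists_coreIdx a i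
    exact ⟨j, hU.2 hUn j hj hc, hV.2 hVn j hj hc⟩
  tau_ki a i j h := by simp only [h]
  ValueO := value F.goodO
  ValueS := value F.goodS
  val n := {i | endpoint i.hist ∈ F.val n}

theorem model_finiteChoice [Finite Agent] : FiniteChoice F.model := by
  intro a m
  refine (((F.lab_fin a).image some).insert none |>.image
    fun x => {h | m ∈ h.val ∧ choiceLab a m h = x}).subset ?_
  rintro _ ⟨h, -, rfl⟩
  refine ⟨choiceLab a m h, ?_, rfl⟩
  rcases m with c | w
  · exact .inr ⟨_, ⟨_, rfl⟩, rfl⟩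
  · exact .inl rfl

theorem value_le_iff {g : Agent → F.World → Prop} {h h' : Hist F.prec} :
    value g h ≤ value g h' ↔ ((∀ a, g a (endpoint h)) → ∀ a, g a (endpoint h')) := by
  unfold value
  split_ifs with h₁ h₂ h₂ <;> simp [h₁, h₂]

/-- If membership of the points of `A L x` in `T` only depends on whether `L` is good and on `x`,
then the undominated elements are the good ones. -/
theorem undominated_iff_good {κ ι H : Type*} {ch : Set κ} {A : κ → ι → Set H} {V : H → ℝ}
    {T : H → Prop} {P q : ι → Prop} {good : κ → Prop}
    (hV : ∀ h h', V h ≤ V h' ↔ (T h → T h'))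
    (hA : ∀ L ∈ ch, ∀ x, P x → ∀ h ∈ A L x, (T h ↔ good L ∧ q x))
    (hne : ∀ L ∈ ch, ∀ x, P x → (A L x).Nonempty)
    (hgood : ∃ L ∈ ch, good L) (hq : ∃ x, P x ∧ q x) {L : κ} (hL : L ∈ ch) :
    (¬ ∃ L' ∈ ch, (∀ x, P x → ∀ h ∈ A L x, ∀ h' ∈ A L' x, V h ≤ V h') ∧
      ¬ ∀ x, P x → ∀ h ∈ A L' x, ∀ h' ∈ A L x, V h ≤ V h') ↔ good L := by
  have key : ∀ L ∈ ch, ∀ L' ∈ ch,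
      (∀ x, P x → ∀ h ∈ A L x, ∀ h' ∈ A L' x, V h ≤ V h') ↔ (good L → good L') := by
    intro L hL L' hL'
    constructor
    · intro H hg
      obtain ⟨x, hx, hqx⟩ := hq
      obtain ⟨h, hh⟩ := hne L hL x hx
      obtain ⟨h', hh'⟩ := hne L' hL' x hx
      exact ((hA L' hL' x hx h' hh').1
        ((hV _ _).1 (H x hx h hh h' hh') ((hA L hL x hx h hh).2 ⟨hg, hqx⟩))).1
    · intro H x hx h hh h' hh'
      rw [hV, hA L hL x hx h hh, hA L' hL' x hx h' hh']
      exact And.imp_left H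
  obtain ⟨L₀, hL₀, hg₀⟩ := hgood
  constructor
  · intro H
    by_contra hg
    refine H ⟨L₀, hL₀, ?_⟩
    rw [key L hL L₀ hL₀, key L₀ hL₀ L hL]
    tauto
  · rintro hg ⟨L', hL', H⟩
    rw [key L hL L' hL', key L' hL' L hL] at H
    tauto

section Deontic

variable {g : Agent → F.World → Prop}

theorem good_cell_iff
    (hg : ∀ {a w v}, F.cls w = F.cls v → F.lab a w = F.lab a v → g a w → g a v) {a : Agent}
    {c : F.Cls} {v : F.World} (hv : F.cls v = c) :
    (∀ h ∈ cell a (.inl c) (F.hist v), g a (endpoint h)) ↔ g a v := by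
  constructor
  · intro H
    simpa using H (F.hist v) (mem_cell_inl.2 ⟨hv, rfl⟩)
  · intro H h hh
    obtain ⟨u, rfl⟩ := exists_hist_eq h
    have := mem_cell_inl.1 hh
    rw [endpoint_hist]
    exact hg (hv.trans this.1.symm) this.2.symm H

theorem goodS_congr_lab {a : Agent} {w v : F.World} (h : F.cls w = F.cls v)
    (h' : F.lab a w = F.lab a v) : F.goodS a w → F.goodS a v :=
  F.goodS_congr (F.info_congr h h')

/-- In a state of the other agents, all of them are in a good position. -/
def othersGood (g : Agent → F.World → Prop) (a : Agent) (m : F.Cls ⊕ F.World)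
    (S : Set (Hist F.prec)) : Prop :=
  ∀ h ∈ S, m ∈ h.val → ∀ b, b ≠ a → g b (endpoint h)

variable [Finite Agent]

theorem forall_good_iff
    (hg : ∀ {a w v}, F.cls w = F.cls v → F.lab a w = F.lab a v → g a w → g a v) {a : Agent}
    {c : F.Cls} {S : Set (Hist F.prec)} (hS : S ∈ stateSet F.model a (.inl c)) {w : F.World}
    (hc : F.cls w = c) (hw : F.hist w ∈ S) :
    (∀ b, g b (endpoint (F.hist w))) ↔ g a w ∧ othersGood g a (.inl c) S := by
  obtain ⟨s, hs, rfl⟩ := hS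
  subst hc
  constructor
  · intro H
    refine ⟨by simpa using H a, fun h hh hm b hb => ?_⟩
    obtain ⟨v, rfl⟩ := exists_hist_eq h
    obtain ⟨k, -, hk⟩ := hs b
    have h₁ := Set.mem_iInter₂.1 hh b hb
    have h₂ := Set.mem_iInter₂.1 hw b hb
    rw [hk] at h₁ h₂
    have hl := h₁.2.trans h₂.2.symm
    simp only [choiceLab, endpoint_hist, Option.some.injEq] at hl
    have H' := H b
    rw [endpoint_hist] at H' ⊢
    exact hg (inl_mem_hist.1 hm).symm hl.symm H'
  · rintro ⟨ha, H⟩ b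
    by_cases hb : b = a
    · subst hb
      simpa using ha
    · exact H _ hw (inl_mem_hist.2 rfl) b hb

theorem exists_othersGood
    (hg : ∀ {a w v}, F.cls w = F.cls v → F.lab a w = F.lab a v → g a w → g a v)
    (hex : ∀ a w, ∃ v, F.cls v = F.cls w ∧ g a v) (a : Agent) (w : F.World) :
    ∃ S ∈ stateSet F.model a (.inl (F.cls w)), othersGood g a (.inl (F.cls w)) S := by
  choose f hf hgf using fun b => hex b w
  refine ⟨_, ⟨fun b => cell b (.inl (F.cls w)) (F.hist (f b)),
    fun b => ⟨_, inl_mem_hist.2 (hf b), rfl⟩, rfl⟩, fun h hh hm b hb => ?_⟩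
  obtain ⟨v, rfl⟩ := exists_hist_eq h
  have := mem_cell_inl.1 (Set.mem_iInter₂.1 hh b hb)
  rw [endpoint_hist]
  exact hg ((hf b).trans this.1.symm) this.2.symm (hgf b)

theorem cell_mem_choice (a : Agent) {c : F.Cls} {v : F.World} (hv : F.cls v = c) :
    cell a (.inl c) (F.hist v) ∈ F.model.Choice a (.inl c) :=
  ⟨_, inl_mem_hist.2 hv, rfl⟩

theorem mem_choice_inl {a : Agent} {c : F.Cls} {L : Set (Hist F.prec)} :
    L ∈ F.model.Choice a (.inl c) ↔ ∃ v, F.cls v = c ∧ L = cell a (.inl c) (F.hist v) := by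
  constructor
  · rintro ⟨h, hm, rfl⟩
    obtain ⟨v, rfl⟩ := exists_hist_eq h
    exact ⟨v, inl_mem_hist.1 hm, rfl⟩
  · rintro ⟨v, hv, rfl⟩
    exact cell_mem_choice a hv

theorem cell_mem_optimal_iff {a : Agent} {c : F.Cls} {v : F.World} (hv : F.cls v = c) :
    cell a (.inl c) (F.hist v) ∈ optimal F.model a (.inl c) ↔ F.goodO a v := by
  rw [← good_cell_iff F.goodO_congr hv]
  refine (and_iff_right (cell_mem_choice a hv)).trans ?_
  subst hv
  refine undominated_iff_good (ch := F.model.Choice a (.inl (F.cls v))) (A := fun L S => L ∩ S)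
    (P := fun S => S ∈ stateSet F.model a (.inl (F.cls v)))
    (q := othersGood F.goodO a (.inl (F.cls v))) (good := fun L => ∀ h ∈ L, F.goodO a (endpoint h))
    (fun _ _ => value_le_iff) ?_ (fun L hL S hS => Choice.inter_state_nonempty hL hS)
    ?_ ?_ (cell_mem_choice a rfl)
  · rintro L hL S hS h ⟨hhL, hhS⟩
    obtain ⟨u, hu, rfl⟩ := mem_choice_inl.1 hL
    obtain ⟨w, rfl⟩ := exists_hist_eq h
    have hw := mem_cell_inl.1 hhL
    rw [good_cell_iff F.goodO_congr hu, forall_good_iff F.goodO_congr hS hw.1 hhS]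
    refine and_congr_left fun _ => ⟨?_, ?_⟩
    · exact F.goodO_congr (hw.1.trans hu.symm) hw.2
    · exact F.goodO_congr (hu.trans hw.1.symm) hw.2.symm
  · obtain ⟨u, hu, hgu⟩ := F.exists_goodO a v
    exact ⟨_, cell_mem_choice a hu, (good_cell_iff F.goodO_congr hu).2 hgu⟩
  · exact exists_othersGood F.goodO_congr F.exists_goodO a v

theorem momRel_inl {a : Agent} {c : F.Cls} {m : F.Cls ⊕ F.World}
    (h : momRel F.model a (.inl c) m) : ∃ c', m = .inl c' := by
  obtain ⟨i, j, hi, rfl, e⟩ := h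
  rcases idx_or_leaf i with ⟨w, rfl⟩ | ⟨w, rfl⟩
  · rcases idx_or_leaf j with ⟨v, rfl⟩ | ⟨v, rfl⟩
    · exact ⟨_, rfl⟩
    · cases e
  · cases hi

theorem mem_cluster_cell_iff {a : Agent} {c c' : F.Cls} {v w : F.World} (hv : F.cls v = c) :
    F.hist w ∈ cluster F.model a (.inl c) (cell a (.inl c) (F.hist v)) (.inl c') ↔
      F.cls w = c' ∧ F.info a v = F.info a w := by
  have key : ∀ q : Sum.inl c' ∈ (F.hist w).val, _ := mem_cluster_iff (cell_mem_choice a hv)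
    (mem_cell_inl.2 ⟨hv, rfl⟩) (inl_mem_hist.2 hv)
  constructor
  · intro h
    obtain ⟨q, -⟩ := id h
    have e := (key q).1 h
    rw [mk_inl, mk_inl] at e
    exact ⟨inl_mem_hist.1 q, epi_idx.1 e⟩
  · rintro ⟨hw, e⟩
    refine (key (inl_mem_hist.2 hw)).2 ?_
    rw [mk_inl, mk_inl]
    exact epi_idx.2 e

theorem cell_mem_soptimal_iff {a : Agent} {c : F.Cls} {v : F.World} (hv : F.cls v = c) :
    cell a (.inl c) (F.hist v) ∈ soptimal F.model a (.inl c) ↔ F.goodS a v := by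
  rw [← good_cell_iff goodS_congr_lab hv]
  refine (and_iff_right (cell_mem_choice a hv)).trans ?_
  subst hv
  have hdom : ∀ L L', domS F.model a (.inl (F.cls v)) L L' ↔
      ∀ x : (F.Cls ⊕ F.World) × Set (Hist F.prec),
        momRel F.model a (.inl (F.cls v)) x.1 ∧ x.2 ∈ stateSet F.model a x.1 →
        leValS F.model (cluster F.model a (.inl (F.cls v)) L x.1 ∩ x.2)
          (cluster F.model a (.inl (F.cls v)) L' x.1 ∩ x.2) := fun L L' =>
    ⟨fun H x hx => H x.1 hx.1 x.2 hx.2, fun H m hm S hS => H (m, S) ⟨hm, hS⟩⟩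
  simp only [sdomS, hdom]
  refine undominated_iff_good (ch := F.model.Choice a (.inl (F.cls v)))
    (A := fun L (x : (F.Cls ⊕ F.World) × Set (Hist F.prec)) =>
      cluster F.model a (.inl (F.cls v)) L x.1 ∩ x.2)
    (P := fun x => momRel F.model a (.inl (F.cls v)) x.1 ∧ x.2 ∈ stateSet F.model a x.1)
    (q := fun x => othersGood F.goodS a x.1 x.2)
    (good := fun L => ∀ h ∈ L, F.goodS a (endpoint h)) (V := value F.goodS)
    (fun _ _ => value_le_iff) ?_
    (fun L hL x hx => cluster_inter_state_nonempty hL hx.1 hx.2) ?_ ?_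
    (cell_mem_choice a rfl)
  · rintro L hL ⟨m, S⟩ ⟨hm, hS⟩ h ⟨hhL, hhS⟩
    obtain ⟨c', rfl⟩ := momRel_inl hm
    obtain ⟨u, hu, rfl⟩ := mem_choice_inl.1 hL
    obtain ⟨w, rfl⟩ := exists_hist_eq h
    have hw := (mem_cluster_cell_iff hu).1 hhL
    rw [good_cell_iff goodS_congr_lab hu, forall_good_iff goodS_congr_lab hS hw.1 hhS]
    exact and_congr_left fun _ => ⟨F.goodS_congr hw.2.symm, F.goodS_congr hw.2⟩
  · obtain ⟨u, hu, hgu⟩ := F.exists_goodS a v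
    exact ⟨_, cell_mem_choice a hu, (good_cell_iff goodS_congr_lab hu).2 hgu⟩
  · obtain ⟨S, hS, hq⟩ := exists_othersGood goodS_congr_lab F.exists_goodS a v
    exact ⟨⟨_, S⟩, ⟨momRel_refl a (F.idx v), hS⟩, hq⟩

end Deontic

theorem truth_model_iff [Finite Agent] (φ : Formula Agent) :
    ∀ w, truth F.model φ (F.idx w) ↔ F.sat φ w := by
  induction φ with
  | atom n =>
    intro w
    change endpoint (F.hist w) ∈ F.val n ↔ w ∈ F.val n
    rw [endpoint_hist]
  | neg φ ih => exact fun w => not_congr (ih w)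
  | conj φ ψ ih₁ ih₂ => exact fun w => and_congr (ih₁ w) (ih₂ w)
  | box φ ih =>
    intro w
    constructor
    · intro H v hv
      have := H (F.hist v) (idx_mom_mem_hist.2 hv)
      rwa [mk_idx_mom, ih] at this
    · intro H h p
      obtain ⟨v, rfl⟩ := exists_hist_eq h
      rw [mk_idx_mom, ih]
      exact H v (inl_mem_hist.1 p)
  | stit a φ ih =>
    intro w
    refine (truth_stit_iff (cell_mem_choice a rfl) (mem_cell_inl.2 ⟨rfl, rfl⟩)).trans ⟨?_, ?_⟩
    · intro H v hv hl
      have := H (F.hist v) (mem_cell_inl.2 ⟨hv, hl⟩) (inl_mem_hist.2 hv)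
      rwa [mk_inl, ih] at this
    · intro H h hh p
      obtain ⟨v, rfl⟩ := exists_hist_eq h
      rw [mk_inl, ih]
      exact H v (mem_cell_inl.1 hh).1 (mem_cell_inl.1 hh).2
  | know a φ ih =>
    intro w
    constructor
    · exact fun H v hv => (ih v).1 (H (F.idx v) (epi_idx.2 hv))
    · intro H j hj
      rcases idx_or_leaf j with ⟨v, rfl⟩ | ⟨v, rfl⟩
      · exact (ih v).2 (H v (epi_idx.1 hj))
      · cases hj
  | intend a φ ih =>
    intro w
    constructor
    · rintro ⟨U, hU, hUn, H⟩ v u huv hu hv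
      refine (ih v).1 (H _ (hU.2 hUn (F.idx v) ?_ ((coreIdx_idx a v).2 hv)))
      refine ⟨F.hist u, idx_mom_mem_hist.2 huv, ?_⟩
      rw [mk_idx_mom]
      exact epi_idx.2 hu
    · intro H
      obtain ⟨k, hk, hck⟩ := exists_coreIdx a (F.idx w)
      refine ⟨{j ∈ exAnte F.epi a (F.idx w) | coreIdx a j},
        ⟨fun j hj => hj.1, fun _ j hj hc => ⟨hj, hc⟩⟩, ⟨k, hk, hck⟩, ?_⟩
      rintro j ⟨⟨h, p, e⟩, hc⟩
      obtain ⟨u, rfl⟩ := exists_hist_eq h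
      rcases idx_or_leaf j with ⟨v, rfl⟩ | ⟨v, rfl⟩
      · rw [mk_idx_mom] at e
        exact (ih v).2 (H v u (inl_mem_hist.1 p) (epi_idx.1 e) ((coreIdx_idx a v).1 hc))
      · cases e
  | oughtO a φ ih =>
    intro w
    constructor
    · intro H v hv hg
      have := H _ ((cell_mem_optimal_iff hv).2 hg) (F.hist v) (mem_cell_inl.2 ⟨hv, rfl⟩)
        (idx_mom_mem_hist.2 hv)
      rwa [mk_idx_mom, ih] at this
    · intro H L hL h hh p
      obtain ⟨v, hv, rfl⟩ := mem_choice_inl.1 hL.1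
      obtain ⟨u, rfl⟩ := exists_hist_eq h
      have hu := mem_cell_inl.1 hh
      rw [mk_idx_mom, ih]
      exact H u hu.1 (F.goodO_congr (hv.trans hu.1.symm) hu.2.symm ((cell_mem_optimal_iff hv).1 hL))
  | oughtS a φ ih =>
    intro w
    constructor
    · intro H v u hu e hg
      have := H _ ((cell_mem_soptimal_iff hu).2 (F.goodS_congr e.symm hg)) (F.idx v).mom
        ⟨F.idx u, F.idx v, congrArg Sum.inl hu, rfl, epi_idx.2 e⟩ (F.hist v)
        ((mem_cluster_cell_iff hu).2 ⟨rfl, e⟩) (idx_mom_mem_hist.2 rfl)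
      rwa [mk_idx_mom, ih] at this
    · intro H L hL m hm h hh p
      obtain ⟨u, hu, rfl⟩ := mem_choice_inl.1 hL.1
      obtain ⟨c, rfl⟩ := momRel_inl hm
      obtain ⟨v, rfl⟩ := exists_hist_eq h
      have hv := (mem_cluster_cell_iff hu).1 hh
      rw [mk_inl, ih]
      exact H v u hu hv.2 (F.goodS_congr hv.2 ((cell_mem_soptimal_iff hu).1 hL))

end LabelledFrame

/-! ### Completeness -/

section Completeness

/-- The subformulas of a formula. -/
def Formula.subformulas : Formula Agent → Set (Formula Agent)
  | .atom n => {.atom n}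
  | .neg φ => insert (.neg φ) φ.subformulas
  | .conj φ ψ => insert (.conj φ ψ) (φ.subformulas ∪ ψ.subformulas)
  | .box φ => insert (.box φ) φ.subformulas
  | .stit a φ => insert (.stit a φ) φ.subformulas
  | .know a φ => insert (.know a φ) φ.subformulas
  | .intend a φ => insert (.intend a φ) φ.subformulas
  | .oughtO a φ => insert (.oughtO a φ) φ.subformulas
  | .oughtS a φ => insert (.oughtS a φ) φ.subformulas

theorem Formula.subformulas_finite (φ : Formula Agent) : φ.subformulas.Finite := by
  induction φ with
  | atom n => exact Set.finite_singleton _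
  | conj φ ψ ih₁ ih₂ => exact (ih₁.union ih₂).insert _
  | neg φ ih | box φ ih | stit a φ ih | know a φ ih | intend a φ ih | oughtO a φ ih
  | oughtS a φ ih => exact ih.insert _

theorem Formula.self_mem_subformulas (φ : Formula Agent) : φ ∈ φ.subformulas := by
  cases φ <;> simp [Formula.subformulas]

/-- The part of a world that lies in a set of formulas. -/
def trace (D : Set (Formula Agent)) (w : World Agent) : Set (Formula Agent) := {χ ∈ D | χ ∈ w}

theorem trace_eq_iff {D : Set (Formula Agent)} {w v : World Agent} :
    trace D w = trace D v ↔ ∀ χ ∈ D, (χ ∈ w ↔ χ ∈ v) := by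
  simp [trace, Set.ext_iff]

variable (Γ : Set (Formula Agent))

/-- The formulas about the attitudes of an agent towards members of `Γ`. -/
def attitudes (a : Agent) : Set (Formula Agent) :=
  Formula.know a '' Γ ∪ Formula.oughtS a '' Γ ∪ Formula.intend a '' Γ

theorem forall_attitudes {Γ : Set (Formula Agent)} {a : Agent} {p : Formula Agent → Prop} :
    (∀ χ ∈ attitudes Γ a, p χ) ↔
      ∀ ψ ∈ Γ, p (.know a ψ) ∧ p (.oughtS a ψ) ∧ p (.intend a ψ) := by
  simp only [attitudes, Set.mem_union, or_imp, forall_and, Set.forall_mem_image, and_assoc]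

/-- The information of an agent at a world: the attitudes at the world together with those at
the worlds of the same moment. -/
def canonicalInfo (a : Agent) (w : World Agent) :
    Set (Formula Agent) × Set (Set (Formula Agent)) :=
  (trace (attitudes Γ a) w, trace (attitudes Γ a) '' {v | SameMoment w v})

/-- The formulas that distinguish the choices of an agent. -/
def choiceFormulas (a : Agent) : Set (Formula Agent) := attitudes Γ a ∪ Formula.stit a '' Γ

/-- The moment of a world. -/
def momentOf (w : World Agent) : Set (Formula Agent) := {χ | .box χ ∈ w}

theorem momentOf_eq_iff {w v : World Agent} : momentOf w = momentOf v ↔ SameMoment w v :=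
  Set.ext_iff

variable {Γ}

theorem trace_attitudes_of_know {a : Agent} {w v : World Agent}
    (h : SameN (Formula.know a) w v) :
    trace (attitudes Γ a) w = trace (attitudes Γ a) v :=
  trace_eq_iff.2 <| forall_attitudes.2 fun ψ _ =>
    ⟨h ψ, ⟨oughtS_mem_of_know h, oughtS_mem_of_know h.symm⟩,
      ⟨intend_mem_of_know h, intend_mem_of_know h.symm⟩⟩

theorem canonicalInfo_of_know {a : Agent} {w v : World Agent}
    (h : SameN (Formula.know a) w v) : canonicalInfo Γ a w = canonicalInfo Γ a v := by
  refine Prod.ext (trace_attitudes_of_know h) (Set.Subset.antisymm ?_ ?_)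
  · rintro _ ⟨w', hw', rfl⟩
    obtain ⟨v', hv', hk⟩ := exists_know_moment h hw'
    exact ⟨v', hv', (trace_attitudes_of_know hk).symm⟩
  · rintro _ ⟨v', hv', rfl⟩
    obtain ⟨w', hw', hk⟩ := exists_know_moment h.symm hv'
    exact ⟨w', hw', (trace_attitudes_of_know hk).symm⟩

theorem image_trace_of_moment {w v : World Agent} (h : SameMoment w v)
    (D : Set (Formula Agent)) :
    trace D '' {u | SameMoment w u} = trace D '' {u | SameMoment v u} :=
  congrArg (trace D '' ·) (Set.ext fun _ => ⟨h.symm.trans, h.trans⟩)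

theorem canonicalInfo_spec {a : Agent} {w v : World Agent}
    (h : canonicalInfo Γ a w = canonicalInfo Γ a v) {ψ : Formula Agent} (hψ : ψ ∈ Γ) :
    (Formula.know a ψ ∈ w ↔ Formula.know a ψ ∈ v) ∧
      (Formula.oughtS a ψ ∈ w ↔ Formula.oughtS a ψ ∈ v) ∧
      (Formula.intend a ψ ∈ w ↔ Formula.intend a ψ ∈ v) :=
  forall_attitudes.1 (trace_eq_iff.1 (congrArg Prod.fst h)) ψ hψ

theorem canonicalInfo_unif {a : Agent} {w v w' : World Agent}
    (h : canonicalInfo Γ a w = canonicalInfo Γ a v) (hw : SameMoment w w') :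
    ∃ v', SameMoment v v' ∧ canonicalInfo Γ a w' = canonicalInfo Γ a v' := by
  have hs := congrArg Prod.snd h
  have hmem : trace (attitudes Γ a) w' ∈ (canonicalInfo Γ a w).2 := ⟨w', hw, rfl⟩
  rw [hs] at hmem
  obtain ⟨v', hv, hv'⟩ := hmem
  exact ⟨v', hv, Prod.ext hv'.symm ((image_trace_of_moment hw.symm _).trans
    (hs.trans (image_trace_of_moment hv _)))⟩

/-- The compatibility of a world with the subjective obligations of an agent. -/
def fulfilsS (Γ : Set (Formula Agent)) (a : Agent) (w : World Agent) : Prop :=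
  ∀ ψ ∈ Γ, Formula.oughtS a ψ ∈ w → Formula.know a ψ ∈ w

theorem fulfilsS_congr {a : Agent} {w v : World Agent}
    (h : canonicalInfo Γ a w = canonicalInfo Γ a v) (hw : fulfilsS Γ a w) : fulfilsS Γ a v :=
  fun ψ hψ hv => (canonicalInfo_spec h hψ).1.1 (hw ψ hψ ((canonicalInfo_spec h hψ).2.1.2 hv))

/-- The canonical frame relative to a finite set of formulas. -/
def canonicalFrame [Finite Agent] (hΓ : Γ.Finite) (w₀ : World Agent) : LabelledFrame Agent where
  World := World Agent
  Cls := Set.range (momentOf (Agent := Agent))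
  Lab := Set (Formula Agent)
  Info := Set (Formula Agent) × Set (Set (Formula Agent))
  ne := ⟨w₀⟩
  cls := Set.rangeFactorization momentOf
  cls_surj := Set.rangeFactorization_surjective
  lab a := trace (choiceFormulas Γ a)
  lab_fin a := by
    have : (choiceFormulas Γ a).Finite :=
      (((hΓ.image _).union (hΓ.image _)).union (hΓ.image _)).union (hΓ.image _)
    refine this.finite_subsets.subset ?_
    rintro _ ⟨w, rfl⟩
    exact Set.sep_subset _ _
  info := canonicalInfo Γ
  indep w f hf := by
    obtain ⟨v, hv, hs⟩ := exists_sameN_stit w f fun a =>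
      (momentOf_eq_iff.1 (congrArg Subtype.val (hf a))).symm
    refine ⟨v, Subtype.ext (momentOf_eq_iff.2 hv.symm), fun a => trace_eq_iff.2 ?_⟩
    rintro χ (hχ | ⟨ψ, -, rfl⟩)
    · exact (trace_eq_iff.1 (trace_attitudes_of_know (hs a).stit_of_know) χ hχ).symm
    · exact (hs a ψ).symm
  info_congr h h' := Prod.ext
    (trace_eq_iff.2 fun χ hχ => trace_eq_iff.1 h' χ (.inl hχ))
    (image_trace_of_moment (momentOf_eq_iff.1 (congrArg Subtype.val h)) _)
  unif h hw := by
    obtain ⟨v', hv, h'⟩ :=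
      canonicalInfo_unif h (momentOf_eq_iff.1 (congrArg Subtype.val hw)).symm
    exact ⟨v', Subtype.ext (momentOf_eq_iff.2 hv.symm), h'⟩
  goodO a w := ∀ ψ ∈ Γ, Formula.oughtO a ψ ∈ w → Formula.stit a ψ ∈ w
  goodO_congr h h' hw ψ hψ hv :=
    (trace_eq_iff.1 h' _ (.inr ⟨ψ, hψ, rfl⟩)).1 (hw ψ hψ
      ((oughtO_mem_iff (momentOf_eq_iff.1 (congrArg Subtype.val h)) ψ).2 hv))
  exists_goodO a w := by
    obtain ⟨v, hv, h, -⟩ := exists_oughtO (oughtO_bot a w)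
    exact ⟨v, Subtype.ext (momentOf_eq_iff.2 hv.symm), fun ψ _ => h ψ⟩
  goodS := fulfilsS Γ
  goodS_congr := fulfilsS_congr
  exists_goodS a w := by
    obtain ⟨u, v, hu, hk, h, -⟩ := exists_oughtS (oughtS_bot a w)
    exact ⟨u, Subtype.ext (momentOf_eq_iff.2 hu.symm),
      fulfilsS_congr (canonicalInfo_of_know hk.symm) fun ψ _ => h ψ⟩
  core a w := ∀ ψ ∈ Γ, Formula.intend a ψ ∈ w → ψ ∈ w
  exists_core a w := by
    obtain ⟨u, v, hk, hu, h, -⟩ := exists_intend (intend_bot a w)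
    exact ⟨v, u, Subtype.ext (momentOf_eq_iff.2 hu), canonicalInfo_of_know hk, fun ψ _ => h ψ⟩
  val n := {w | .atom n ∈ w}

section Truth

variable [Finite Agent] {hΓ : Γ.Finite} {w₀ : World Agent}

theorem canonicalFrame_cls_eq_iff {w v : World Agent} :
    (canonicalFrame hΓ w₀).cls w = (canonicalFrame hΓ w₀).cls v ↔ SameMoment w v :=
  Subtype.ext_iff.trans momentOf_eq_iff

theorem mem_iff_sat (φ : Formula Agent) (hφ : φ.subformulas ⊆ Γ) :
    ∀ w : World Agent, φ ∈ w ↔ (canonicalFrame hΓ w₀).sat φ w := by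
  induction φ with
  | atom n => exact fun w => Iff.rfl
  | neg φ ih =>
    exact fun w => (World.neg_mem w).trans (not_congr (ih ((Set.subset_insert _ _).trans hφ) w))
  | conj φ ψ ih₁ ih₂ =>
    have hφ' := (Set.subset_insert _ _).trans hφ
    exact fun w => (World.conj_mem w).trans (and_congr
      (ih₁ (Set.subset_union_left.trans hφ') w) (ih₂ (Set.subset_union_right.trans hφ') w))
  | box φ ih =>
    have ih := ih ((Set.subset_insert _ _).trans hφ)
    intro w
    constructor
    · exact fun h v hv =>
        (ih v).1 (isS5_box.mem_of_sameN (canonicalFrame_cls_eq_iff.1 hv).symm h)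
    · intro H
      by_contra h
      obtain ⟨v, hv, hn⟩ := isS5_box.exists_sameN h
      exact hn ((ih v).2 (H v (canonicalFrame_cls_eq_iff.2 hv.symm)))
  | stit a φ ih =>
    have hsub := (Set.subset_insert _ _).trans hφ
    have ih := ih hsub
    intro w
    constructor
    · intro h v _ hl
      refine (ih v).1 ((isS5_stit a).mem_of_mem ?_)
      exact (trace_eq_iff.1 hl _ (.inr ⟨φ, hsub φ.self_mem_subformulas, rfl⟩)).2 h
    · intro H
      by_contra h
      obtain ⟨v, hv, hn⟩ := (isS5_stit a).exists_sameN h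
      refine hn ((ih v).2 (H v (canonicalFrame_cls_eq_iff.2 hv.moment_of_stit.symm) ?_))
      refine trace_eq_iff.2 ?_
      rintro χ (hχ | ⟨ψ, -, rfl⟩)
      · exact (trace_eq_iff.1 (trace_attitudes_of_know hv.stit_of_know) χ hχ).symm
      · exact (hv ψ).symm
  | know a φ ih =>
    have hsub := (Set.subset_insert _ _).trans hφ
    have ih := ih hsub
    intro w
    constructor
    · intro h v hv
      exact (ih v).1 ((isS5_know a).mem_of_mem
        ((canonicalInfo_spec hv (hsub φ.self_mem_subformulas)).1.1 h))
    · intro H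
      by_contra h
      obtain ⟨v, hv, hn⟩ := (isS5_know a).exists_sameN h
      exact hn ((ih v).2 (H v (canonicalInfo_of_know hv)))
  | intend a φ ih =>
    have hsub := (Set.subset_insert _ _).trans hφ
    have ih := ih hsub
    have hmem := hsub φ.self_mem_subformulas
    intro w
    constructor
    · intro h v u huv hu hv
      exact (ih v).1 (hv φ hmem (intend_mem_of_moment (canonicalFrame_cls_eq_iff.1 huv)
        ((canonicalInfo_spec hu hmem).2.2.1 h)))
    · intro H
      by_contra h
      obtain ⟨u, v, hk, hu, hc, hn⟩ := exists_intend h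
      exact hn ((ih v).2 (H v u (canonicalFrame_cls_eq_iff.2 hu) (canonicalInfo_of_know hk)
        fun ψ _ => hc ψ))
  | oughtO a φ ih =>
    have hsub := (Set.subset_insert _ _).trans hφ
    have ih := ih hsub
    intro w
    constructor
    · intro h v hv hg
      exact (ih v).1 ((isS5_stit a).mem_of_mem (hg φ (hsub φ.self_mem_subformulas)
        ((oughtO_mem_iff (canonicalFrame_cls_eq_iff.1 hv) φ).2 h)))
    · intro H
      by_contra h
      obtain ⟨v, hv, hg, hn⟩ := exists_oughtO h
      exact hn ((ih v).2 (H v (canonicalFrame_cls_eq_iff.2 hv.symm) fun ψ _ => hg ψ))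
  | oughtS a φ ih =>
    have hsub := (Set.subset_insert _ _).trans hφ
    have ih := ih hsub
    have hmem := hsub φ.self_mem_subformulas
    intro w
    constructor
    · intro h v u hu e hg
      exact (ih v).1 ((isS5_know a).mem_of_mem (hg φ hmem ((canonicalInfo_spec e hmem).2.1.1
        (oughtS_mem_of_moment (canonicalFrame_cls_eq_iff.1 hu).symm h))))
    · intro H
      by_contra h
      obtain ⟨u, v, hu, hk, hg, hn⟩ := exists_oughtS h
      exact hn ((ih v).2 (H v u (canonicalFrame_cls_eq_iff.2 hu.symm)
        (canonicalInfo_of_know hk) fun ψ _ => hg ψ))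

end Truth

theorem Lambda_R'.complete [Finite Agent] {φ : Formula Agent}
    (h : ∀ (Mom : Type) (lt : Mom → Mom → Prop) (M : BiKiobtModel Agent Mom lt),
      FiniteChoice M → ∀ i : Idx lt, truth M φ i) : Lambda_R' φ := by
  refine .of_forall_world fun w => ?_
  let F := canonicalFrame φ.subformulas_finite w
  exact (mem_iff_sat φ subset_rfl w).2 ((F.truth_model_iff φ w).1
    (h _ _ F.model F.model_finiteChoice _))

end Completeness

/-- soundness and completeness of `Λ_R'` with respect to
finite-choice bi-valued kiobt-models. -/
theorem Lambda_R'_sound_complete {Agent : Type} [Finite Agent] (φ : Formula Agent) :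
    Lambda_R' φ ↔
      ∀ (Mom : Type) (lt : Mom → Mom → Prop) (M : BiKiobtModel Agent Mom lt),
        FiniteChoice M → ∀ i : Idx lt, truth M φ i :=
  ⟨Lambda_R'.sound, Lambda_R'.complete⟩

end IEAUST
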